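/- arXiv:1102.3992 — 7 statements merged into one kernel-verified Lean document; each statement's English description precedes it below -/
import Mathlib

section
/- Let H ∈ (1/2, 1) and set α_H = H(2H−1). There exists a constant C_H > 0, depending only on H, such that for every t > 0 and every complex number z with Re z ≥ 0, the quantity N_t(z) := α_H ∫₀ᵗ ∫₀ᵗ e^{−(r+s)·Re z} · cos((r−s)·Im z) · |r−s|^{2H−2} dr ds satisfies N_t(z) ≤ C_H · (1/(1/t + Re z))^{2H}. -/
open MeasureTheory Real

/-- The power `x ^ p` cut off beyond `d`, composed with `|·|`, is integrable, with explicit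
integral. -/
lemma integrable_integral_indicator_abs_rpow {p d : ℝ} (hp : -1 < p) (hd : 0 < d) :
    Integrable (fun x : ℝ => (Set.Iic d).indicator (fun y => y ^ p) |x|) ∧
      ∫ x : ℝ, (Set.Iic d).indicator (fun y => y ^ p) |x| = 2 * (d ^ (p + 1) / (p + 1)) := by
  have hset : Set.Ioi (0 : ℝ) ∩ Set.Iic d = Set.Ioc 0 d := rfl
  have hval : ∫ x : ℝ, (Set.Iic d).indicator (fun y => y ^ p) |x| =
      2 * (d ^ (p + 1) / (p + 1)) := by
    rw [integral_comp_abs (f := (Set.Iic d).indicator fun y => y ^ p),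
      setIntegral_indicator measurableSet_Iic, hset, ← intervalIntegral.integral_of_le hd.le,
      integral_rpow (Or.inl hp), zero_rpow (by linarith), sub_zero]
  have hp1 : 0 < p + 1 := by linarith
  have hpos : 0 < 2 * (d ^ (p + 1) / (p + 1)) := by positivity
  exact ⟨.of_integral_ne_zero (hval ▸ hpos.ne'), hval⟩

lemma intervalIntegral_exp_neg_mul_le {b : ℝ} (hb : 0 < b) (t : ℝ) :
    ∫ s in (0 : ℝ)..t, exp (-(s * b)) ≤ 1 / b := by
  have hderiv : ∀ s ∈ Set.uIcc 0 t,
      HasDerivAt (fun s => -exp (-(s * b)) / b) (exp (-(s * b))) s := by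
    intro s _
    have h : HasDerivAt (fun s => -exp (-(s * b)) / b) (-(exp (-(s * b)) * -(1 * b)) / b) s :=
      ((hasDerivAt_id s).mul_const b).fun_neg.exp.fun_neg.div_const b
    rwa [one_mul, mul_neg, neg_neg, mul_div_cancel_right₀ _ hb.ne'] at h
  rw [intervalIntegral.integral_eq_sub_of_hasDerivAt hderiv
    (Continuous.intervalIntegrable (by fun_prop) _ _)]
  have := div_pos (exp_pos (-(t * b))) hb
  simp only [zero_mul, neg_zero, exp_zero, neg_div]
  linarith

lemma exp_neg_mul_abs_rpow_le {p b : ℝ} (hp : p ≤ 0) (hb : 0 < b) {s : ℝ} (hs : 0 ≤ s) (x : ℝ) :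
    exp (-(s * b)) * |x| ^ p ≤
      (Set.Iic (1 / b)).indicator (fun y => y ^ p) |x| + b ^ (-p) * exp (-(s * b)) := by
  have hexp : exp (-(s * b)) ≤ 1 := exp_le_one_iff.2 (by nlinarith)
  have hpow : 0 ≤ |x| ^ p := rpow_nonneg (abs_nonneg x) p
  by_cases h : |x| ≤ 1 / b
  · rw [Set.indicator_of_mem (Set.mem_Iic.2 h)]
    have : 0 ≤ b ^ (-p) * exp (-(s * b)) := by positivity
    nlinarith
  · rw [Set.indicator_of_notMem (by simpa using h), zero_add, mul_comm]
    have h1 : |x| ^ p ≤ (1 / b) ^ p :=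
      rpow_le_rpow_of_nonpos (by positivity) (not_le.1 h).le hp
    rw [one_div, inv_rpow hb.le, ← rpow_neg hb.le] at h1
    gcongr

/-- The convolution of a damped exponential with `|·| ^ p` is bounded uniformly in the
singularity. -/
lemma intervalIntegral_indicator_add_exp_le {p b t : ℝ} (hp : -1 < p) (hb : 0 < b) (ht : 0 ≤ t)
    (r : ℝ) :
    IntervalIntegrable (fun s => (Set.Iic (1 / b)).indicator (fun y => y ^ p) |r - s| +
        b ^ (-p) * exp (-(s * b))) volume 0 t ∧
      ∫ s in (0 : ℝ)..t, ((Set.Iic (1 / b)).indicator (fun y => y ^ p) |r - s| +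
        b ^ (-p) * exp (-(s * b))) ≤ (2 / (p + 1) + 1) * b ^ (-p - 1) := by
  obtain ⟨hint, hval⟩ := integrable_integral_indicator_abs_rpow hp (one_div_pos.2 hb)
  have hint' := hint.comp_sub_left r
  have hexp : IntervalIntegrable (fun s => b ^ (-p) * exp (-(s * b))) volume 0 t :=
    Continuous.intervalIntegrable (by fun_prop) _ _
  refine ⟨hint'.intervalIntegrable.add hexp, ?_⟩
  rw [intervalIntegral.integral_add hint'.intervalIntegrable hexp,
    intervalIntegral.integral_const_mul]
  have hnear : ∫ s in (0 : ℝ)..t, (Set.Iic (1 / b)).indicator (fun y => y ^ p) |r - s| ≤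
      2 * ((1 / b) ^ (p + 1) / (p + 1)) := by
    rw [← hval, intervalIntegral.integral_of_le ht,
      ← integral_sub_left_eq_self (fun x => (Set.Iic (1 / b)).indicator (fun y => y ^ p) |x|)
        volume r]
    refine setIntegral_le_integral hint' (Filter.Eventually.of_forall fun s => ?_)
    by_cases h : |r - s| ∈ Set.Iic (1 / b)
    · simp only [Set.indicator_of_mem h, Pi.zero_apply]
      positivity
    · simp only [Set.indicator_of_notMem h, Pi.zero_apply, le_refl]
  have hfar : b ^ (-p) * ∫ s in (0 : ℝ)..t, exp (-(s * b)) ≤ b ^ (-p) * (1 / b) := by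
    gcongr
    exact intervalIntegral_exp_neg_mul_le hb t
  have h1 : (1 / b) ^ (p + 1) = b ^ (-p - 1) := by
    rw [one_div, inv_rpow hb.le, ← rpow_neg hb.le]
    ring_nf
  have h2 : b ^ (-p) * (1 / b) = b ^ (-p - 1) := by
    rw [rpow_sub_one hb.ne', mul_one_div]
  rw [h1] at hnear
  rw [h2] at hfar
  calc _ ≤ 2 * (b ^ (-p - 1) / (p + 1)) + b ^ (-p - 1) := add_le_add hnear hfar
    _ = _ := by ring

/-- Upper bound of Theorem 3.1: for `H ∈ (1/2,1)`, `α_H = H(2H-1)`, there is a constant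
`C_H > 0` such that for all `t > 0` and all `z ∈ ℂ` with `Re z ≥ 0`,
`N_t(z) = α_H ∫₀ᵗ∫₀ᵗ e^{-(r+s)Re z} cos((r-s)Im z) |r-s|^{2H-2} dr ds`
satisfies `N_t(z) ≤ C_H (1/(1/t + Re z))^{2H}`. -/
theorem parabolic_Nt_upper_bound (H : ℝ) (hH : 1/2 < H) (hH1 : H < 1) :
    ∃ C : ℝ, 0 < C ∧
      ∀ t : ℝ, 0 < t → ∀ z : ℂ, 0 ≤ z.re →
        (H * (2*H - 1)) *
          ∫ r in (0:ℝ)..t, ∫ s in (0:ℝ)..t,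
            Real.exp (-((r + s) * z.re)) * Real.cos ((r - s) * z.im) *
              |r - s| ^ (2*H - 2)
        ≤ C * (1 / (1/t + z.re)) ^ (2*H) := by
  have hH' : 0 < 2 * H - 1 := by linarith
  have hH0 : 0 < H := by linarith
  set K : ℝ := 2 / (2 * H - 2 + 1) + 1 with hK
  have hK0 : 0 < K := by
    have : 0 < 2 * H - 2 + 1 := by linarith
    positivity
  refine ⟨H * (2 * H - 1) * (exp 2 * K), by positivity, fun t ht z hz => ?_⟩
  set b : ℝ := 1 / t + z.re with hb
  have hb0 : 0 < b := by positivity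
  rw [mul_assoc (H * (2 * H - 1))]
  refine mul_le_mul_of_nonneg_left ?_ (by positivity)
  have hdamp : ∀ r ≤ t, ∀ s ≤ t,
      exp (-((r + s) * z.re)) ≤ exp 2 * exp (-(r * b)) * exp (-(s * b)) := by
    intro r hr s hs
    rw [← exp_add, ← exp_add, exp_le_exp, hb]
    have h1 : r * (1 / t) ≤ 1 := by rw [mul_one_div]; exact (div_le_one ht).2 hr
    have h2 : s * (1 / t) ≤ 1 := by rw [mul_one_div]; exact (div_le_one ht).2 hs
    linarith
  have hinner : ∀ r ∈ Set.Ioc 0 t,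
      ‖∫ s in (0 : ℝ)..t, exp (-((r + s) * z.re)) * cos ((r - s) * z.im) *
        |r - s| ^ (2 * H - 2)‖ ≤ exp 2 * (K * b ^ (-(2 * H - 2) - 1)) * exp (-(r * b)) := by
    intro r hr
    obtain ⟨hint, hle⟩ := intervalIntegral_indicator_add_exp_le
      (p := 2 * H - 2) (by linarith) hb0 ht.le r
    refine (intervalIntegral.norm_integral_le_of_norm_le ht.le
      (Filter.Eventually.of_forall fun s hs => ?_)
      (hint.const_mul (exp 2 * exp (-(r * b))))).trans ?_
    · have hpow : 0 ≤ |r - s| ^ (2 * H - 2) := by positivity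
      rw [norm_mul, norm_mul, norm_of_nonneg (exp_pos _).le, norm_of_nonneg hpow,
        Real.norm_eq_abs]
      calc _ ≤ exp (-((r + s) * z.re)) * 1 * |r - s| ^ (2 * H - 2) := by
            gcongr
            exact abs_cos_le_one _
        _ ≤ exp 2 * exp (-(r * b)) * exp (-(s * b)) * |r - s| ^ (2 * H - 2) := by
            rw [mul_one]
            gcongr
            exact hdamp r hr.2 s hs.2
        _ ≤ _ := by
            rw [mul_assoc (exp 2 * exp (-(r * b)))]
            gcongr
            exact exp_neg_mul_abs_rpow_le (by linarith) hb0 hs.1.le _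
    · rw [intervalIntegral.integral_const_mul]
      calc _ ≤ exp 2 * exp (-(r * b)) * (K * b ^ (-(2 * H - 2) - 1)) := by gcongr
        _ = _ := by ring
  refine (le_norm_self _).trans <| (intervalIntegral.norm_integral_le_of_norm_le ht.le
    (Filter.Eventually.of_forall hinner)
    (Continuous.intervalIntegrable (by fun_prop) _ _)).trans ?_
  rw [intervalIntegral.integral_const_mul]
  calc _ ≤ exp 2 * (K * b ^ (-(2 * H - 2) - 1)) * (1 / b) := by
        gcongr
        exact intervalIntegral_exp_neg_mul_le hb0 t
    _ = exp 2 * K * (b ^ (-(2 * H - 2) - 1) / b) := by ring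
    _ = _ := by
        rw [← rpow_sub_one hb0.ne', one_div, inv_rpow hb0.le, ← rpow_neg hb0.le]
        ring_nf
end

section
/- Let H ∈ (1/2, 1), α_H = H(2H−1), and K > 0. There exists a constant C_{H,K} > 0, depending only on H and K, such that for every t > 0 and every complex number z with Re z ≥ 0 and |Im z| ≤ K · Re z, the quantity N_t(z) := α_H ∫₀ᵗ ∫₀ᵗ e^{−(r+s)·Re z} · cos((r−s)·Im z) · |r−s|^{2H−2} dr ds satisfies N_t(z) ≥ C_{H,K} · (1/(1/t + Re z))^{2H}. -/
open MeasureTheory Real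

/-- A quadratic form with an even difference kernel, written as an integral of the kernel against
the autocorrelation. -/
lemma integral_integral_mul_even_sub {f k : ℝ → ℝ} {t : ℝ} (ht : 0 ≤ t) (hf : Continuous f)
    (hk : ∀ x, k (-x) = k x) (hki : IntervalIntegrable k volume (-t) t) :
    ∫ r in (0:ℝ)..t, ∫ s in (0:ℝ)..t, f r * f s * k (r - s) =
      2 * ∫ v in (0:ℝ)..t, k v * ∫ r in (0:ℝ)..(t - v), f r * f (r + v) := by
  set u : ℝ → ℝ := (Set.Ioc 0 t).indicator f with hu
  set k' : ℝ → ℝ := (Set.Ioc (-t) t).indicator k with hk'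
  have hum : Measurable u := hf.measurable.indicator measurableSet_Ioc
  have hui : Integrable u :=
    (integrable_indicator_iff measurableSet_Ioc).2 ((hf.integrableOn_Icc).mono_set
      Set.Ioc_subset_Icc_self)
  have hk'i : Integrable k' :=
    (integrable_indicator_iff measurableSet_Ioc).2
      ((intervalIntegrable_iff_integrableOn_Ioc_of_le (by linarith)).1 hki)
  obtain ⟨M, hM⟩ : ∃ M, ∀ x, ‖u x‖ ≤ M := by
    obtain ⟨M, hM⟩ := (isCompact_Icc (a := (0:ℝ)) (b := t)).exists_bound_of_continuousOn
      hf.continuousOn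
    refine ⟨max M 0, fun x => ?_⟩
    by_cases hx : x ∈ Set.Ioc 0 t
    · simp only [hu, Set.indicator_of_mem hx]
      exact (hM x (Set.Ioc_subset_Icc_self hx)).trans (le_max_left _ _)
    · simp [hu, Set.indicator_of_notMem hx]
  have hkk' : ∀ r v, u r * u (r - v) * k v = u (r - v) * (u r * k' v) := by
    intro r v
    by_cases hr : r ∈ Set.Ioc 0 t
    · by_cases hv : r - v ∈ Set.Ioc 0 t
      · have : v ∈ Set.Ioc (-t) t := ⟨by linarith [hr.1, hv.2], by linarith [hr.2, hv.1]⟩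
        simp only [hk', Set.indicator_of_mem this]
        ring
      · simp [hu, Set.indicator_of_notMem hv]
    · simp [hu, Set.indicator_of_notMem hr]
  have hint : Integrable (Function.uncurry fun r v => u r * u (r - v) * k v)
      (volume.prod volume) := by
    have h : (Function.uncurry fun r v => u r * u (r - v) * k v) =
        fun z : ℝ × ℝ => u (z.1 - z.2) * (u z.1 * k' z.2) := by
      ext z
      exact hkk' z.1 z.2
    rw [h]
    exact (hui.mul_prod hk'i).bdd_mul (c := M)
      (hum.comp (measurable_fst.sub measurable_snd)).aestronglyMeasurable
      (Filter.Eventually.of_forall fun z => hM _)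
  have hcorr_even : ∀ v, ∫ r, u r * u (r - v) = ∫ r, u r * u (r - |v|) := by
    intro v
    rcases abs_choice v with h | h
    · rw [h]
    · rw [h, ← integral_add_right_eq_self _ v]
      congr 1
      ext r
      simp [mul_comm]
  have hk_abs : ∀ v, k |v| = k v := by
    intro v
    rcases abs_choice v with h | h <;> rw [h]
    exact hk v
  calc ∫ r in (0:ℝ)..t, ∫ s in (0:ℝ)..t, f r * f s * k (r - s)
      = ∫ r, ∫ s, u r * u s * k (r - s) := by
        rw [intervalIntegral.integral_of_le ht, ← integral_indicator measurableSet_Ioc]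
        congr 1
        ext r
        by_cases hr : r ∈ Set.Ioc 0 t
        · rw [Set.indicator_of_mem hr, intervalIntegral.integral_of_le ht,
            ← integral_indicator measurableSet_Ioc]
          congr 1
          ext s
          by_cases hs : s ∈ Set.Ioc 0 t
          · simp only [hu, Set.indicator_of_mem hr, Set.indicator_of_mem hs]
          · simp [hu, Set.indicator_of_notMem hs]
        · simp [hu, Set.indicator_of_notMem hr]
    _ = ∫ r, ∫ v, u r * u (r - v) * k v := by
        congr 1
        ext r
        rw [← integral_sub_left_eq_self _ volume r]
        simp
    _ = ∫ v, ∫ r, u r * u (r - v) * k v := integral_integral_swap hint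
    _ = ∫ v, (fun w => k w * ∫ r, u r * u (r - w)) |v| := by
        congr 1
        ext v
        simp only
        rw [integral_mul_const, hcorr_even, hk_abs, mul_comm]
    _ = 2 * ∫ v in Set.Ioi 0, k v * ∫ r, u r * u (r - v) :=
        integral_comp_abs (f := fun w => k w * ∫ r, u r * u (r - w))
    _ = 2 * ∫ v in (0:ℝ)..t, k v * ∫ r in (0:ℝ)..(t - v), f r * f (r + v) := by
        rw [intervalIntegral.integral_of_le ht, ← integral_indicator measurableSet_Ioc,
          ← integral_indicator measurableSet_Ioi]
        congr 2
        ext v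
        by_cases hv : v ∈ Set.Ioc 0 t
        · rw [Set.indicator_of_mem hv, Set.indicator_of_mem (Set.mem_Ioi.2 hv.1),
            ← integral_add_right_eq_self _ v, intervalIntegral.integral_of_le (by linarith [hv.2]),
            ← integral_indicator measurableSet_Ioc]
          congr 2
          ext r
          by_cases hr : r ∈ Set.Ioc 0 (t - v)
          · have h1 : r ∈ Set.Ioc 0 t := ⟨hr.1, by linarith [hr.2, hv.1]⟩
            have h2 : r + v ∈ Set.Ioc 0 t := ⟨by linarith [hr.1, hv.1], by linarith [hr.2]⟩
            simp only [hu, add_sub_cancel_right, Set.indicator_of_mem hr,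
              Set.indicator_of_mem h1, Set.indicator_of_mem h2]
            ring
          · rw [Set.indicator_of_notMem hr, add_sub_cancel_right]
            by_cases h1 : 0 < r
            · have h2 : r + v ∉ Set.Ioc 0 t := fun h => hr ⟨h1, by linarith [h.2]⟩
              simp [hu, Set.indicator_of_notMem h2]
            · have h2 : r ∉ Set.Ioc 0 t := fun h => h1 h.1
              simp [hu, Set.indicator_of_notMem h2]
        · rw [Set.indicator_of_notMem hv]
          by_cases h0 : 0 < v
          · rw [Set.indicator_of_mem (Set.mem_Ioi.2 h0)]
            have : ∀ r, u r * u (r - v) = 0 := by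
              intro r
              by_cases hr : r ∈ Set.Ioc 0 t
              · have h2 : r - v ∉ Set.Ioc 0 t :=
                  fun h => hv ⟨h0, by linarith [h.1, hr.2]⟩
                simp [hu, Set.indicator_of_notMem h2]
              · simp [hu, Set.indicator_of_notMem hr]
            simp [this]
          · rw [Set.indicator_of_notMem (by simpa using h0)]

/-- First and second primitives of `v ↦ cos (b * v)` vanishing at `0`, including `b = 0`. -/
lemma exists_cos_primitives (b : ℝ) : ∃ S C : ℝ → ℝ,
    (∀ v, HasDerivAt S (cos (b * v)) v) ∧ (∀ v, HasDerivAt C (S v) v) ∧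
    S 0 = 0 ∧ C 0 = 0 ∧ (∀ v, 0 ≤ C v) ∧ (∀ v, |S v| ≤ |v|) ∧ (∀ v, C v ≤ v ^ 2) ∧
    ∀ v, |b * v| ≤ 1 → v ^ 2 / 8 ≤ C v := by
  rcases eq_or_ne b 0 with rfl | hb
  · refine ⟨fun v => v, fun v => v ^ 2 / 2, fun v => by simpa using hasDerivAt_id' v,
      fun v => by simpa using (hasDerivAt_pow 2 v).div_const 2, rfl, by simp,
      fun v => by positivity, fun v => le_rfl, fun v => ?_, fun v _ => ?_⟩ <;>
    nlinarith [sq_nonneg v]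
  · have hb2 : 0 < b ^ 2 := by positivity
    have hlin : ∀ v, HasDerivAt (fun v => b * v) b v := fun v => by
      simpa using (hasDerivAt_id' v).const_mul b
    refine ⟨fun v => sin (b * v) / b, fun v => (1 - cos (b * v)) / b ^ 2, fun v => ?_,
      fun v => ?_, by simp, by simp, fun v => ?_, fun v => ?_, fun v => ?_, fun v hv => ?_⟩
    · exact ((hlin v).sin.div_const b).congr_deriv (by field_simp)
    · exact (((hlin v).cos.const_sub 1).div_const (b ^ 2)).congr_deriv (by field_simp)
    · exact div_nonneg (by linarith [cos_le_one (b * v)]) hb2.le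
    · rw [abs_div, div_le_iff₀ (abs_pos.2 hb), ← abs_mul, mul_comm v]
      exact abs_sin_le_abs
    · rw [div_le_iff₀ hb2]
      nlinarith [one_sub_sq_div_two_le_cos (x := b * v), sq_nonneg (b * v)]
    · rw [le_div_iff₀ hb2]
      have h := cos_le_one_sub_mul_cos_sq (hv.trans (by linarith [pi_gt_three]))
      have hpi : 1 / 8 ≤ 2 / π ^ 2 := by
        rw [div_le_div_iff₀ (by norm_num) (by positivity)]
        nlinarith [pi_pos, pi_lt_d2]
      nlinarith [mul_le_mul_of_nonneg_right hpi (sq_nonneg (b * v))]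

/-- A quantitative form of Pólya's positivity of cosine transforms of convex decreasing
functions, for the product of a negative power and a convex decreasing function. -/
lemma le_integral_cos_mul_rpow_mul_convex {e b m v₀ t : ℝ} {φ ψ χ : ℝ → ℝ}
    (he : -1 < e) (he0 : e < 0) (hv₀ : 0 < v₀) (hv₀t : v₀ ≤ t) (hb : |b| * v₀ ≤ 1) (hm : 0 ≤ m)
    (hφ : ∀ v, HasDerivAt φ (-ψ v) v) (hψ : ∀ v, HasDerivAt ψ (-χ v) v)
    (hφ0 : ∀ v ∈ Set.Icc 0 t, 0 ≤ φ v) (hψ0 : ∀ v ∈ Set.Icc 0 t, 0 ≤ ψ v)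
    (hχ0 : ∀ v ∈ Set.Icc 0 t, 0 ≤ χ v) (hφt : φ t = 0) (hφm : ∀ v ∈ Set.Icc 0 v₀, m ≤ φ v) :
    -e * m / 8 / (e + 1) * v₀ ^ (e + 1) ≤
      ∫ v in (0:ℝ)..t, cos (b * v) * v ^ e * φ v := by
  obtain ⟨S, C, hS, hC, hS0, hC0, hCnn, hSle, hCle, hCge⟩ := exists_cos_primitives b
  have ht : 0 < t := hv₀.trans_le hv₀t
  set F : ℝ → ℝ := fun v => S v * (v ^ e * φ v) + C v * (-e * v ^ (e - 1) * φ v + v ^ e * ψ v)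
    with hF
  set F' : ℝ → ℝ := fun v => cos (b * v) * v ^ e * φ v -
    C v * (e * (e - 1) * v ^ (e - 2) * φ v - 2 * e * v ^ (e - 1) * ψ v + v ^ e * χ v) with hF'
  have hφc : Continuous φ := continuous_iff_continuousAt.2 fun v => (hφ v).continuousAt
  have hψc : Continuous ψ := continuous_iff_continuousAt.2 fun v => (hψ v).continuousAt
  have hderiv : ∀ v, 0 < v → HasDerivAt F (F' v) v := by
    intro v hv
    have h1 : HasDerivAt (fun v : ℝ => v ^ e) (e * v ^ (e - 1)) v :=
      hasDerivAt_rpow_const (Or.inl hv.ne')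
    have h2 : HasDerivAt (fun v : ℝ => v ^ (e - 1)) ((e - 1) * v ^ (e - 2)) v := by
      convert hasDerivAt_rpow_const (p := e - 1) (Or.inl hv.ne') using 3
      ring
    refine (((hS v).mul (h1.mul (hφ v))).add
      ((hC v).mul (((h2.const_mul (-e)).mul (hφ v)).add (h1.mul (hψ v))))).congr_deriv ?_
    simp only [hF', Pi.mul_apply, Pi.add_apply]
    ring
  have hFcont0 : ContinuousWithinAt F (Set.Ici 0) 0 := by
    have hF0 : F 0 = 0 := by simp [hF, hS0, hC0]
    rw [ContinuousWithinAt, hF0]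
    have hcont : Filter.Tendsto (fun v : ℝ => v ^ (e + 1) * (2 * |φ v| + |v| * |ψ v|))
        (nhdsWithin 0 (Set.Ici 0)) (nhds 0) := by
      have h : ContinuousAt (fun v : ℝ => v ^ (e + 1) * (2 * |φ v| + |v| * |ψ v|)) 0 := by
        have := continuousAt_rpow_const (0:ℝ) (e + 1) (Or.inr (by linarith))
        fun_prop
      have := h.tendsto
      rw [zero_rpow (by linarith), zero_mul] at this
      exact this.mono_left nhdsWithin_le_nhds
    refine squeeze_zero_norm' ?_ hcont
    filter_upwards [self_mem_nhdsWithin] with v hv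
    rcases eq_or_lt_of_le (Set.mem_Ici.1 hv) with rfl | hv
    · simp [hF0, zero_rpow (show e + 1 ≠ 0 by linarith)]
    have hpow1 : v ^ (e + 1) = v * v ^ e := by rw [rpow_add hv, rpow_one, mul_comm]
    have hpow2 : v ^ (e + 1) = v ^ 2 * v ^ (e - 1) := by
      rw [← rpow_natCast, ← rpow_add hv]; congr 1; push_cast; ring
    have hC' : |C v| ≤ v ^ 2 := by rw [abs_of_nonneg (hCnn v)]; exact hCle v
    have hS' : |S v| ≤ v := (hSle v).trans_eq (abs_of_pos hv)
    have hA := rpow_pos_of_pos hv e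
    have hB := rpow_pos_of_pos hv (e - 1)
    calc ‖F v‖ ≤ |S v| * (v ^ e * |φ v|) + |C v| * (-e * v ^ (e - 1) * |φ v| + v ^ e * |ψ v|) := by
          rw [Real.norm_eq_abs]
          refine (abs_add_le _ _).trans ?_
          rw [abs_mul, abs_mul, abs_mul, abs_of_pos hA]
          gcongr
          refine (abs_add_le _ _).trans ?_
          rw [abs_mul, abs_mul, abs_mul, abs_of_pos hA, abs_of_pos hB, abs_of_pos (neg_pos.2 he0)]
      _ ≤ v * (v ^ e * |φ v|) + v ^ 2 * (1 * v ^ (e - 1) * |φ v| + v ^ e * |ψ v|) := by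
          have : -e ≤ 1 := by linarith
          have : 0 < -e := by linarith
          gcongr
      _ = v ^ (e + 1) * (2 * |φ v| + |v| * |ψ v|) := by
          rw [abs_of_pos hv]
          linear_combination (-(|φ v|) - v * |ψ v|) * hpow1 - |φ v| * hpow2
  have hFcont : ContinuousOn F (Set.Icc 0 t) := by
    intro v hv
    rcases eq_or_lt_of_le hv.1 with rfl | h
    · exact hFcont0.mono Set.Icc_subset_Ici_self
    · exact (hderiv v h).continuousAt.continuousWithinAt
  have hint : IntervalIntegrable (fun v => cos (b * v) * v ^ e * φ v) volume 0 t := by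
    have h := (intervalIntegral.intervalIntegrable_rpow' (a := 0) (b := t) he).mul_continuousOn
      (g := fun v => cos (b * v) * φ v) (by fun_prop)
    exact h.congr (fun v _ => by ring)
  have hintOn : IntegrableOn (fun v => cos (b * v) * v ^ e * φ v) (Set.Icc 0 t) :=
    (intervalIntegrable_iff_integrableOn_Icc_of_le ht.le).1 hint
  have hmid : v₀ ∈ Set.Icc 0 t := ⟨hv₀.le, hv₀t⟩
  have hF't : ∀ v, 0 < v → v ≤ t →
      F' v + C v * (e * (e - 1) * v ^ (e - 2) * φ v) ≤ cos (b * v) * v ^ e * φ v := by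
    intro v hv hvt
    have h1 : 0 ≤ C v * (-e * v ^ (e - 1) * ψ v) :=
      mul_nonneg (hCnn v) (mul_nonneg (mul_nonneg (by linarith) (rpow_nonneg hv.le _))
        (hψ0 v ⟨hv.le, hvt⟩))
    have h2 : 0 ≤ C v * (v ^ e * χ v) :=
      mul_nonneg (hCnn v) (mul_nonneg (rpow_nonneg hv.le _) (hχ0 v ⟨hv.le, hvt⟩))
    simp only [hF']
    linarith
  have hee : 0 ≤ e * (e - 1) := by nlinarith
  have hright : F t - F v₀ ≤ ∫ v in v₀..t, cos (b * v) * v ^ e * φ v := by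
    refine intervalIntegral.sub_le_integral_of_hasDeriv_right_of_le hv₀t
      (hFcont.mono (Set.Icc_subset_Icc_left hv₀.le))
      (fun v hv => (hderiv v (hv₀.trans hv.1)).hasDerivWithinAt)
      (hintOn.mono_set (Set.Icc_subset_Icc_left hv₀.le)) fun v hv => ?_
    have hv0 := hv₀.trans hv.1
    have : 0 ≤ C v * (e * (e - 1) * v ^ (e - 2) * φ v) :=
      mul_nonneg (hCnn v) (mul_nonneg (mul_nonneg hee (rpow_nonneg hv0.le _))
        (hφ0 v ⟨hv0.le, hv.2.le⟩))
    linarith [hF't v hv0 hv.2.le]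
  set c : ℝ := -e * m / 8 / (e + 1) with hc
  have hleft : (F v₀ + c * v₀ ^ (e + 1)) - (F 0 + c * 0 ^ (e + 1)) ≤
      ∫ v in (0:ℝ)..v₀, cos (b * v) * v ^ e * φ v := by
    refine intervalIntegral.sub_le_integral_of_hasDeriv_right_of_le
      (g := fun v => F v + c * v ^ (e + 1)) (g' := fun v => F' v + -e * m / 8 * v ^ e) hv₀.le
      ((hFcont.mono (Set.Icc_subset_Icc_right hv₀t)).add (continuousOn_const.mul
        (continuousOn_id.rpow_const fun _ _ => Or.inr (by linarith))))
      (fun v hv => ?_) (hintOn.mono_set (Set.Icc_subset_Icc_right hv₀t)) fun v hv => ?_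
    · have h1 : HasDerivAt (fun v : ℝ => v ^ (e + 1)) ((e + 1) * v ^ e) v := by
        convert hasDerivAt_rpow_const (p := e + 1) (Or.inl hv.1.ne') using 3
        ring
      have hne : e + 1 ≠ 0 := by linarith
      exact (((hderiv v hv.1).add (h1.const_mul c)).congr_deriv
        (by rw [hc]; field_simp)).hasDerivWithinAt
    · have hb' : |b * v| ≤ 1 := by
        rw [abs_mul, abs_of_pos hv.1]
        exact (mul_le_mul_of_nonneg_left hv.2.le (abs_nonneg b)).trans hb
      have hpow : v ^ e = v ^ 2 * v ^ (e - 2) := by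
        rw [← rpow_natCast, ← rpow_add hv.1]; congr 1; push_cast; ring
      have hCv := hCge v hb'
      have hφv := hφm v ⟨hv.1.le, hv.2.le⟩
      have hA := rpow_nonneg hv.1.le (e - 2)
      have hee1 : -e ≤ e * (e - 1) := by nlinarith
      have : 0 ≤ -e := by linarith
      have : -e * m / 8 * v ^ e ≤ C v * (e * (e - 1) * v ^ (e - 2) * φ v) := by
        calc -e * m / 8 * v ^ e = v ^ 2 / 8 * (-e * v ^ (e - 2) * m) := by rw [hpow]; ring
          _ ≤ _ := by gcongr; exact hCnn v
      linarith [hF't v hv.1 (hv.2.le.trans hv₀t)]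
  rw [← intervalIntegral.integral_add_adjacent_intervals
    (hint.mono_set (Set.uIcc_subset_uIcc_left (by rwa [Set.uIcc_of_le ht.le])))
    (hint.mono_set (Set.uIcc_subset_uIcc_right (by rwa [Set.uIcc_of_le ht.le])))]
  have hFt : 0 ≤ F t := by
    simp only [hF, hφt]
    have := mul_nonneg (hCnn t) (mul_nonneg (rpow_nonneg ht.le e) (hψ0 t ⟨ht.le, le_rfl⟩))
    simpa using this
  have hF0 : F 0 = 0 := by simp [hF, hS0, hC0]
  rw [hF0, zero_rpow (by linarith)] at hleft
  linarith

/-- Lower bound of Theorem 3.1: for `H ∈ (1/2,1)`, `α_H = H(2H-1)` and `K > 0`, there is a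
constant `C_{H,K} > 0` such that for all `t > 0` and all `z ∈ ℂ` with `Re z ≥ 0` and
`|Im z| ≤ K Re z`,
`N_t(z) = α_H ∫₀ᵗ∫₀ᵗ e^{-(r+s)Re z} cos((r-s)Im z) |r-s|^{2H-2} dr ds`
satisfies `N_t(z) ≥ C_{H,K} (1/(1/t + Re z))^{2H}`. -/
theorem parabolic_Nt_lower_bound (H : ℝ) (hH : 1/2 < H) (hH1 : H < 1)
    (K : ℝ) (hK : 0 < K) :
    ∃ C : ℝ, 0 < C ∧
      ∀ t : ℝ, 0 < t → ∀ z : ℂ, 0 ≤ z.re → |z.im| ≤ K * z.re →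
        C * (1 / (1/t + z.re)) ^ (2*H) ≤
          (H * (2*H - 1)) *
            ∫ r in (0:ℝ)..t, ∫ s in (0:ℝ)..t,
              Real.exp (-((r + s) * z.re)) * Real.cos ((r - s) * z.im) *
                |r - s| ^ (2*H - 2) := by
  have hα : 0 < H * (2 * H - 1) := mul_pos (by linarith) (by linarith)
  set e : ℝ := 2 * H - 2 with he
  have he1 : 0 < e + 1 := by linarith
  have hκ : 0 < -e * exp (-2) / 8 / (e + 1) * (1 / (2 * (1 + K))) ^ (e + 1) :=
    mul_pos (div_pos (div_pos (mul_pos (by linarith) (exp_pos _)) (by norm_num)) he1)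
      (rpow_pos_of_pos (by positivity) _)
  refine ⟨_, mul_pos hα hκ, fun t ht z hz hzK => ?_⟩
  set a := z.re
  set b := z.im
  set ℓ : ℝ := 1 / (1 / t + a) with hℓ
  have hden : 0 < 1 / t + a := by positivity
  have hℓ0 : 0 < ℓ := by positivity
  have hℓt : ℓ ≤ t := by
    rw [hℓ, div_le_iff₀ hden]
    have : t * (1 / t + a) = 1 + t * a := by field_simp
    nlinarith [mul_nonneg ht.le hz]
  have hℓa : a * ℓ ≤ 1 := by
    rw [hℓ, mul_one_div, div_le_one hden]
    linarith [one_div_pos.2 ht]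
  rw [mul_assoc]
  refine mul_le_mul_of_nonneg_left ?_ hα.le
  set Φ : ℝ → ℝ := fun u => ∫ r in (0:ℝ)..u, 2 * exp (-(2 * a * r)) with hΦ
  have hΦd : ∀ u, HasDerivAt Φ (2 * exp (-(2 * a * u))) u := fun u =>
    intervalIntegral.integral_hasDerivAt_right
      (Continuous.intervalIntegrable (by fun_prop) _ _)
      (Continuous.stronglyMeasurableAtFilter (by fun_prop) _ _)
      (Continuous.continuousAt (by fun_prop))
  set φ : ℝ → ℝ := fun v => exp (-(a * v)) * Φ (t - v) with hφ
  have hexp : ∀ v, HasDerivAt (fun v => exp (-(a * v))) (-a * exp (-(a * v))) v := fun v => by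
    refine ((hasDerivAt_id' v).const_mul a).fun_neg.exp.congr_deriv ?_
    ring
  have hexp' : ∀ v, HasDerivAt (fun v => exp (-(a * (2 * t - v))))
      (a * exp (-(a * (2 * t - v)))) v := fun v => by
    refine (((hasDerivAt_id' v).const_sub (2 * t)).const_mul a).fun_neg.exp.congr_deriv ?_
    ring
  have hφd : ∀ v, HasDerivAt φ (-(a * φ v + 2 * exp (-(a * (2 * t - v))))) v := fun v => by
    refine ((hexp v).mul ((hΦd (t - v)).comp v ((hasDerivAt_id' v).const_sub t))).congr_deriv ?_
    have : exp (-(a * (2 * t - v))) = exp (-(a * v)) * exp (-(2 * a * (t - v))) := by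
      rw [← exp_add]; congr 1; ring
    simp only [hφ, this, Function.comp]
    ring
  have hψd : ∀ v, HasDerivAt (fun v => a * φ v + 2 * exp (-(a * (2 * t - v)))) (-(a ^ 2 * φ v)) v :=
      fun v => by
    refine (((hφd v).const_mul a).add ((hexp' v).const_mul 2)).congr_deriv ?_
    ring
  have hΦ0 : ∀ u, 0 ≤ u → 0 ≤ Φ u := fun u hu =>
    intervalIntegral.integral_nonneg hu fun r _ => by positivity
  have hφ0 : ∀ v ∈ Set.Icc 0 t, 0 ≤ φ v := fun v hv =>
    mul_nonneg (exp_pos _).le (hΦ0 _ (by linarith [hv.2]))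
  set v₀ : ℝ := 1 / (2 * (1 + K)) * ℓ with hv₀
  have hv₀0 : 0 < v₀ := by positivity
  have hv₀ℓ : v₀ ≤ ℓ / 2 := by
    have : 1 / (2 * (1 + K)) ≤ 1 / 2 := one_div_le_one_div_of_le (by norm_num) (by linarith)
    nlinarith
  have hbv₀ : |b| * v₀ ≤ 1 := by
    calc |b| * v₀ ≤ (K * a) * v₀ := by gcongr
      _ = K / (2 * (1 + K)) * (a * ℓ) := by rw [hv₀]; ring
      _ ≤ 1 * 1 := by
        gcongr
        rw [div_le_one (by positivity)]
        linarith
      _ = 1 := one_mul 1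
  have hφm : ∀ v ∈ Set.Icc 0 v₀, ℓ * exp (-2) ≤ φ v := by
    intro v hv
    have hle : ℓ / 2 ≤ t - v := by linarith [hv.2]
    have h1 : Φ (ℓ / 2) ≤ Φ (t - v) :=
      monotone_of_hasDerivAt_nonneg hΦd (fun u => by positivity) hle
    have h2 : ℓ * exp (-1) ≤ Φ (ℓ / 2) := by
      have : ∫ r in (0:ℝ)..(ℓ / 2), 2 * exp (-1) ≤ Φ (ℓ / 2) := by
        refine intervalIntegral.integral_mono_on (by positivity) (by simp)
          (Continuous.intervalIntegrable (by fun_prop) _ _) fun r hr => ?_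
        have : a * r ≤ a * (ℓ / 2) := mul_le_mul_of_nonneg_left hr.2 hz
        gcongr
        linarith
      rw [intervalIntegral.integral_const, smul_eq_mul] at this
      linarith
    have h3 : exp (-1) ≤ exp (-(a * v)) := by
      have : a * v ≤ a * ℓ := mul_le_mul_of_nonneg_left (by linarith [hv.2]) hz
      gcongr
      linarith
    calc ℓ * exp (-2) = exp (-1) * (ℓ * exp (-1)) := by
          rw [show (-2:ℝ) = -1 + -1 by norm_num, exp_add]; ring
      _ ≤ exp (-(a * v)) * Φ (t - v) := by
          gcongr
          exact h2.trans h1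
  have hmain := le_integral_cos_mul_rpow_mul_convex (by linarith) (by linarith) hv₀0
    (by linarith) hbv₀ (by positivity) hφd hψd hφ0
    (fun v hv => add_nonneg (mul_nonneg hz (hφ0 v hv)) (by positivity))
    (fun v hv => mul_nonneg (sq_nonneg a) (hφ0 v hv)) (by simp [hφ, hΦ]) hφm (e := e)
  have hki : IntervalIntegrable (fun v : ℝ => cos (v * b) * |v| ^ e) volume (-t) t := by
    have h : IntervalIntegrable (fun v : ℝ => |v| ^ e) volume (-t) t := by
      refine intervalIntegrable_of_even (fun v => by simp) fun x hx => ?_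
      refine (intervalIntegral.intervalIntegrable_rpow' (show -1 < e by linarith)).congr
        fun v hv => ?_
      rw [Set.uIoc_of_le hx.le] at hv
      simp [abs_of_pos hv.1]
    exact h.continuousOn_mul (by fun_prop)
  have hred := integral_integral_mul_even_sub (f := fun r => exp (-(r * a))) ht.le
    (by fun_prop) (fun v => by simp) hki
  calc _ = -e * (ℓ * exp (-2)) / 8 / (e + 1) * v₀ ^ (e + 1) := by
        rw [hv₀, mul_rpow (by positivity) hℓ0.le, show 2 * H = e + 1 + 1 by rw [he]; ring,
          rpow_add_one hℓ0.ne' (e + 1)]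
        ring
    _ ≤ _ := hmain
    _ = _ := by
        rw [← intervalIntegral.integral_const_mul] at hred
        convert hred.symm using 1
        · refine intervalIntegral.integral_congr_ae (Filter.Eventually.of_forall fun v hv => ?_)
          rw [Set.uIoc_of_le ht.le] at hv
          have : φ v = 2 * ∫ r in (0:ℝ)..(t - v), exp (-(r * a)) * exp (-((r + v) * a)) := by
            simp only [hφ, hΦ]
            rw [← intervalIntegral.integral_const_mul, ← intervalIntegral.integral_const_mul]
            congr 1
            ext r
            rw [← exp_add, mul_left_comm, ← exp_add]
            congr 2
            ring
          rw [this, abs_of_pos hv.1, mul_comm b v]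
          ring
        · congr 1
          ext r
          congr 1
          ext s
          rw [← exp_add, mul_assoc]
          congr 2
          ring
end

section
/- Let H ∈ (1/2, 1) and α_H = H(2H−1). There exists a constant D_H > 0, depending only on H, such that for every t > 0 and every a > 0, the quantity N_t(a) := (α_H / a) ∫₀ᵗ ∫₀ᵗ sin(r√a) · sin(s√a) · |r−s|^{2H−2} dr ds satisfies N_t(a) ≤ D_H · t · (1/(1/t² + a))^{H+1/2}. -/
open MeasureTheory Real

/-- A bounded factor against a power with integrable singularity at the origin. -/
lemma abs_integral_mul_rpow_le {β : ℝ} (hβ : -1 < β) {k : ℝ → ℝ} {M c : ℝ} (hc : 0 ≤ c)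
    (hk : ∀ u ∈ Set.Ioc 0 c, |k u| ≤ M) :
    |∫ u in (0:ℝ)..c, k u * u ^ β| ≤ M * (c ^ (β + 1) / (β + 1)) := by
  have h : ‖∫ u in (0:ℝ)..c, k u * u ^ β‖ ≤ ∫ u in (0:ℝ)..c, M * u ^ β := by
    refine intervalIntegral.norm_integral_le_of_norm_le hc (ae_of_all _ fun u hu => ?_)
      ((intervalIntegral.intervalIntegrable_rpow' hβ).const_mul M)
    have hu0 : 0 ≤ u ^ β := rpow_nonneg hu.1.le _
    rw [norm_mul, norm_eq_abs, norm_eq_abs, abs_of_nonneg hu0]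
    exact mul_le_mul_of_nonneg_right (hk u hu) hu0
  rwa [intervalIntegral.integral_const_mul, integral_rpow (Or.inl hβ),
    zero_rpow (by linarith), sub_zero, norm_eq_abs] at h

/-- Integration by parts bounds an oscillating integral against a decreasing power. -/
lemma abs_integral_sin_mul_rpow_le_of_pos {β : ℝ} (hβ0 : β < 0) {φ ω b x c : ℝ}
    (hb : 0 < b) (hω : |ω| = b) (hx : 0 < x) (hxc : x ≤ c) :
    |∫ u in x..c, sin (φ + ω * u) * u ^ β| ≤ 2 * (x ^ β / b) := by
  have hω0 : ω ≠ 0 := by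
    rintro rfl
    simp at hω
    linarith
  have hpos : ∀ u ∈ Set.uIcc x c, 0 < u := fun u hu => by
    rw [Set.uIcc_of_le hxc] at hu
    exact hx.trans_le hu.1
  have hd : ∀ u ∈ Set.uIcc x c, HasDerivAt (fun u : ℝ => u ^ β) (β * u ^ (β - 1)) u :=
    fun u hu => hasDerivAt_rpow_const (Or.inl (hpos u hu).ne')
  have hs : ∀ u ∈ Set.uIcc x c,
      HasDerivAt (fun u : ℝ => -cos (φ + ω * u) / ω) (sin (φ + ω * u)) u := fun u _ => by
    have h1 : HasDerivAt (fun u : ℝ => φ + ω * u) ω u := by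
      simpa using ((hasDerivAt_id u).const_mul ω).const_add φ
    refine (h1.cos.neg.div_const ω).congr_deriv ?_
    rw [neg_mul, neg_neg, mul_div_cancel_right₀ _ hω0]
  have h_int : IntervalIntegrable (fun u : ℝ => β * u ^ (β - 1)) volume x c := by
    refine ContinuousOn.intervalIntegrable fun u hu => ContinuousAt.continuousWithinAt ?_
    exact (continuousAt_rpow_const u (β - 1) (Or.inl (hpos u hu).ne')).const_mul β
  have hsint : IntervalIntegrable (fun u : ℝ => sin (φ + ω * u)) volume x c :=
    Continuous.intervalIntegrable (by fun_prop) _ _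
  have hparts := intervalIntegral.integral_mul_deriv_eq_deriv_mul hd hs h_int hsint
  have hftc := intervalIntegral.integral_eq_sub_of_hasDerivAt hd h_int
  have hcos : ∀ u, |-cos (φ + ω * u) / ω| ≤ 1 / b := fun u => by
    rw [abs_div, abs_neg, hω]
    exact div_le_div_of_nonneg_right (abs_cos_le_one _) hb.le
  have hrem : ‖∫ u in x..c, β * u ^ (β - 1) * (-cos (φ + ω * u) / ω)‖ ≤
      ∫ u in x..c, (-(1 / b)) * (β * u ^ (β - 1)) := by
    refine intervalIntegral.norm_integral_le_of_norm_le hxc (ae_of_all _ fun u hu => ?_)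
      (h_int.const_mul _)
    have hneg : β * u ^ (β - 1) ≤ 0 :=
      mul_nonpos_of_nonpos_of_nonneg hβ0.le (rpow_nonneg (hx.trans hu.1).le _)
    rw [norm_mul, norm_eq_abs, norm_eq_abs, abs_of_nonpos hneg]
    nlinarith [hcos u]
  rw [intervalIntegral.integral_const_mul, hftc, norm_eq_abs] at hrem
  have hbd : ∀ u, 0 < u → |u ^ β * (-cos (φ + ω * u) / ω)| ≤ u ^ β * (1 / b) := fun u hu => by
    rw [abs_mul, abs_of_nonneg (rpow_nonneg hu.le _)]
    exact mul_le_mul_of_nonneg_left (hcos u) (rpow_nonneg hu.le _)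
  have hcomm : (∫ u in x..c, sin (φ + ω * u) * u ^ β) =
      ∫ u in x..c, u ^ β * sin (φ + ω * u) :=
    intervalIntegral.integral_congr fun u _ => mul_comm _ _
  rw [hcomm, hparts]
  have h1 := abs_le.mp (hbd c (hx.trans_le hxc))
  have h2 := abs_le.mp (hbd x hx)
  have h3 := abs_le.mp hrem
  have h4 : x ^ β / b = x ^ β * (1 / b) := by ring
  rw [h4, abs_le]
  constructor <;> nlinarith

/-- An oscillating integral against an integrable power is bounded uniformly in its length. -/
lemma abs_integral_sin_mul_rpow_le {β : ℝ} (hβ : -1 < β) (hβ0 : β < 0) {φ ω b c : ℝ}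
    (hb : 0 < b) (hω : |ω| = b) (hc : 0 ≤ c) :
    |∫ u in (0:ℝ)..c, sin (φ + ω * u) * u ^ β| ≤ (1 / (β + 1) + 2) * b ^ (-(β + 1)) := by
  have hβ1 : 0 < β + 1 := by linarith
  have hP : 0 < b ^ (-(β + 1)) := rpow_pos_of_pos hb _
  have hinv : (1 / b) ^ (β + 1) = b ^ (-(β + 1)) := by
    rw [one_div, inv_rpow hb.le, rpow_neg hb.le]
  have hb0 : 0 < 1 / b := by positivity
  rcases le_total c (1 / b) with h | h
  · have h1 := abs_integral_mul_rpow_le hβ (k := fun u => sin (φ + ω * u)) hc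
      fun u _ => abs_sin_le_one _
    have h2 : c ^ (β + 1) ≤ b ^ (-(β + 1)) := hinv ▸ rpow_le_rpow hc h hβ1.le
    have h3 : c ^ (β + 1) / (β + 1) ≤ b ^ (-(β + 1)) / (β + 1) :=
      div_le_div_of_nonneg_right h2 hβ1.le
    have h4 : (1 / (β + 1) + 2) * b ^ (-(β + 1)) =
      b ^ (-(β + 1)) / (β + 1) + 2 * b ^ (-(β + 1)) := by ring
    linarith
  · have h1 := abs_integral_mul_rpow_le hβ (k := fun u => sin (φ + ω * u)) hb0.le
      fun u _ => abs_sin_le_one _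
    have h2 := abs_integral_sin_mul_rpow_le_of_pos hβ0 (φ := φ) hb hω hb0 h
    have h3 : (1 / b) ^ β / b = b ^ (-(β + 1)) := by
      rw [← hinv, rpow_add_one hb0.ne']
      ring
    have h_int : ∀ y z : ℝ,
        IntervalIntegrable (fun u : ℝ => sin (φ + ω * u) * u ^ β) volume y z := fun y z =>
      (intervalIntegral.intervalIntegrable_rpow' hβ).continuousOn_mul
        (Continuous.continuousOn (by fun_prop))
    rw [← intervalIntegral.integral_add_adjacent_intervals (h_int 0 (1 / b)) (h_int (1 / b) c)]
    refine (abs_add_le _ _).trans ((add_le_add h1 h2).trans_eq ?_)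
    rw [h3, hinv]
    ring

/-- Folding an integral against `|r - s| ^ β` at the singularity. -/
lemma integral_mul_abs_sub_rpow {β : ℝ} (hβ : -1 < β) {g : ℝ → ℝ} (hg : Continuous g)
    {r t : ℝ} (hr : 0 ≤ r) (hrt : r ≤ t) :
    ∫ s in (0:ℝ)..t, g s * |r - s| ^ β =
      (∫ u in (0:ℝ)..(t - r), g (r + u) * u ^ β) + ∫ u in (0:ℝ)..r, g (r - u) * u ^ β := by
  have hright : ∀ (k : ℝ → ℝ), Continuous k → ∀ c, 0 ≤ c →
      IntervalIntegrable (fun u => k u * |u| ^ β) volume 0 c := fun k hk c hc => by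
    refine ((intervalIntegral.intervalIntegrable_rpow' hβ).continuousOn_mul
      hk.continuousOn).congr fun u hu => ?_
    rw [Set.uIoc_of_le hc] at hu
    simp only [abs_of_pos hu.1]
  have hI1 : IntervalIntegrable (fun u => g (r - u) * |u| ^ β) volume 0 r :=
    hright _ (by fun_prop) r hr
  have hI2 : IntervalIntegrable (fun u => g (r - u) * |u| ^ β) volume (r - t) 0 := by
    have := (hright (fun u => g (r + u)) (by fun_prop) (t - r) (by linarith)).symm
    simpa [sub_eq_add_neg] using this.comp_sub_left 0
  have h1 := intervalIntegral.integral_comp_sub_left (a := 0) (b := t)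
    (fun u => g (r - u) * |u| ^ β) r
  simp only [sub_sub_cancel, sub_zero] at h1
  rw [h1, ← intervalIntegral.integral_add_adjacent_intervals hI2 hI1]
  have h2 := intervalIntegral.integral_comp_neg (a := 0) (b := t - r)
    (fun u => g (r - u) * |u| ^ β)
  simp only [neg_sub, neg_zero, sub_neg_eq_add, abs_neg] at h2
  rw [← h2]
  congr 1
  · refine intervalIntegral.integral_congr fun u hu => ?_
    rw [Set.uIcc_of_le (by linarith)] at hu
    simp only [abs_of_nonneg hu.1]
  · refine intervalIntegral.integral_congr fun u hu => ?_
    rw [Set.uIcc_of_le hr] at hu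
    simp only [abs_of_nonneg hu.1]

lemma abs_integral_sin_mul_abs_sub_rpow_le {β : ℝ} (hβ : -1 < β) (hβ0 : β < 0) {b r t : ℝ}
    (hb : 0 < b) (hr : 0 ≤ r) (hrt : r ≤ t) :
    |∫ s in (0:ℝ)..t, sin (s * b) * |r - s| ^ β| ≤
      2 * (1 / (β + 1) + 2) * b ^ (-(β + 1)) := by
  rw [integral_mul_abs_sub_rpow hβ (g := fun s => sin (s * b)) (by fun_prop) hr hrt]
  have h1 := abs_integral_sin_mul_rpow_le hβ hβ0 (φ := r * b) (ω := b) hb (abs_of_pos hb)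
    (sub_nonneg.2 hrt)
  have h2 := abs_integral_sin_mul_rpow_le hβ hβ0 (φ := r * b) (ω := -b) hb
    (by rw [abs_neg, abs_of_pos hb]) hr
  have e1 : ∀ u, r * b + b * u = (r + u) * b := fun u => by ring
  have e2 : ∀ u, r * b + -b * u = (r - u) * b := fun u => by ring
  simp only [e1] at h1
  simp only [e2] at h2
  refine (abs_add_le _ _).trans ((add_le_add h1 h2).trans_eq ?_)
  ring

lemma abs_sin_mul_le {b t s : ℝ} (hb : 0 < b) (hs : 0 ≤ s) (hst : s ≤ t) :
    |sin (s * b)| ≤ t * b := by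
  refine abs_sin_le_abs.trans ?_
  rw [abs_of_nonneg (by positivity)]
  gcongr

lemma abs_integral_sin_mul_abs_sub_rpow_le_of_small {β : ℝ} (hβ : -1 < β) {b r t : ℝ}
    (hb : 0 < b) (hr : 0 ≤ r) (hrt : r ≤ t) :
    |∫ s in (0:ℝ)..t, sin (s * b) * |r - s| ^ β| ≤
      2 * (1 / (β + 1) + 2) * (t * b * t ^ (β + 1)) := by
  rw [integral_mul_abs_sub_rpow hβ (g := fun s => sin (s * b)) (by fun_prop) hr hrt]
  have hβ1 : 0 < β + 1 := by linarith
  have ht : 0 ≤ t := hr.trans hrt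
  have h1 := abs_integral_mul_rpow_le hβ (k := fun u => sin ((r + u) * b)) (M := t * b)
    (sub_nonneg.2 hrt)
    fun u hu => abs_sin_mul_le hb (by linarith [hu.1]) (by linarith [hu.2])
  have h2 := abs_integral_mul_rpow_le hβ (k := fun u => sin ((r - u) * b)) (M := t * b) hr
    fun u hu => abs_sin_mul_le hb (by linarith [hu.2]) (by linarith [hu.1])
  have h3 : ∀ c, 0 ≤ c → c ≤ t →
      t * b * (c ^ (β + 1) / (β + 1)) ≤ t * b * (t ^ (β + 1) / (β + 1)) := fun c hc hct => by
    gcongr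
  have h4 : 0 ≤ t * b * t ^ (β + 1) := by positivity
  have h5 : t * b * (t ^ (β + 1) / (β + 1)) = 1 / (β + 1) * (t * b * t ^ (β + 1)) := by ring
  refine (abs_add_le _ _).trans ?_
  have := h3 _ (sub_nonneg.2 hrt) (by linarith)
  have := h3 _ hr hrt
  linarith

/-- Upper bound of Theorem 4.3: for `H ∈ (1/2,1)` and `α_H = H(2H-1)`, there is a constant
`D_H > 0` such that for all `t > 0` and `a > 0`,
`N_t(a) = (α_H/a) ∫₀ᵗ∫₀ᵗ sin(r√a) sin(s√a) |r-s|^{2H-2} dr ds`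
satisfies `N_t(a) ≤ D_H · t · (1/(1/t² + a))^{H+1/2}`. -/
theorem hyperbolic_Nt_upper_bound (H : ℝ) (hH : 1/2 < H) (hH1 : H < 1) :
    ∃ D : ℝ, 0 < D ∧
      ∀ t : ℝ, 0 < t → ∀ a : ℝ, 0 < a →
        (H * (2*H - 1) / a) *
          ∫ r in (0:ℝ)..t, ∫ s in (0:ℝ)..t,
            Real.sin (r * Real.sqrt a) * Real.sin (s * Real.sqrt a) *
              |r - s| ^ (2*H - 2)
        ≤ D * t * (1 / (1/t^2 + a)) ^ (H + 1/2) := by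
  have hβ : -1 < 2 * H - 2 := by linarith
  have hβ0 : 2 * H - 2 < 0 := by linarith
  have hβ1 : 0 < 2 * H - 2 + 1 := by linarith
  have hα : 0 < H * (2 * H - 1) := mul_pos (by linarith) (by linarith)
  obtain ⟨K, hK⟩ : ∃ K, K = 2 * (1 / (2 * H - 2 + 1) + 2) := ⟨_, rfl⟩
  have hK0 : 0 < K := by rw [hK]; positivity
  have hp : 0 < H + 1 / 2 := by linarith
  refine ⟨2 ^ (H + 1/2) * (H * (2 * H - 1) * K), by positivity, fun t ht a ha => ?_⟩
  obtain ⟨b, hbdef⟩ : ∃ b, b = √a := ⟨_, rfl⟩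
  have hb : 0 < b := hbdef ▸ sqrt_pos.2 ha
  have hab : a = b ^ 2 := by rw [hbdef, sq_sqrt ha.le]
  rw [← hbdef]
  have houter : ∀ A B : ℝ, (∀ r ∈ Set.Ioc 0 t, |sin (r * b)| ≤ A) →
      (∀ r ∈ Set.Ioc 0 t, |∫ s in (0:ℝ)..t, sin (s * b) * |r - s| ^ (2 * H - 2)| ≤ B) →
      (∫ r in (0:ℝ)..t, ∫ s in (0:ℝ)..t, sin (r * b) * sin (s * b) * |r - s| ^ (2 * H - 2))
        ≤ A * B * t := fun A B hA hB => by
    have h : ‖∫ r in (0:ℝ)..t, ∫ s in (0:ℝ)..t,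
        sin (r * b) * sin (s * b) * |r - s| ^ (2 * H - 2)‖ ≤ A * B * |t - 0| := by
      refine intervalIntegral.norm_integral_le_of_norm_le_const fun r hr => ?_
      rw [Set.uIoc_of_le ht.le] at hr
      simp only [mul_assoc]
      rw [intervalIntegral.integral_const_mul, norm_mul, norm_eq_abs, norm_eq_abs]
      exact mul_le_mul (hA r hr) (hB r hr) (abs_nonneg _) ((abs_nonneg _).trans (hA r hr))
    rw [sub_zero, abs_of_pos ht] at h
    exact (le_abs_self _).trans h
  have hscale : ∀ x : ℝ, 0 < x → 1 / t ^ 2 + a ≤ 2 / x →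
      x ^ (H + 1/2) ≤ 2 ^ (H + 1/2) * (1 / (1 / t ^ 2 + a)) ^ (H + 1/2) := fun x hx hle => by
    rw [← mul_rpow (by norm_num) (by positivity)]
    refine rpow_le_rpow hx.le ?_ hp.le
    rw [mul_one_div, le_div_iff₀ (by positivity)]
    rwa [le_div_iff₀ hx, mul_comm] at hle
  have hconclude : ∀ x I : ℝ, 0 < x → 1 / t ^ 2 + a ≤ 2 / x →
      I ≤ a * (K * t * x ^ (H + 1/2)) →
      H * (2 * H - 1) / a * I ≤ 2 ^ (H + 1/2) * (H * (2 * H - 1) * K) * t *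
        (1 / (1 / t ^ 2 + a)) ^ (H + 1/2) := fun x I hx hle hI => by
    calc H * (2 * H - 1) / a * I
        ≤ H * (2 * H - 1) / a * (a * (K * t * x ^ (H + 1/2))) := by gcongr
      _ = H * (2 * H - 1) * K * t * x ^ (H + 1/2) := by field_simp
      _ ≤ H * (2 * H - 1) * K * t *
          (2 ^ (H + 1/2) * (1 / (1 / t ^ 2 + a)) ^ (H + 1/2)) := by
        gcongr
        exact hscale x hx hle
      _ = _ := by ring
  rcases le_total a (1 / t ^ 2) with h | h
  · refine hconclude (t ^ 2) _ (by positivity) ?_ ((houter (t * b)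
      (K * (t * b * t ^ (2 * H - 2 + 1)))
      (fun r hr => abs_sin_mul_le hb hr.1.le hr.2) fun r hr => hK ▸
        abs_integral_sin_mul_abs_sub_rpow_le_of_small hβ hb hr.1.le hr.2).trans_eq ?_)
    · have : 2 / t ^ 2 = 1 / t ^ 2 + 1 / t ^ 2 := by ring
      linarith
    · have e : (t ^ 2) ^ (H + 1/2) = t ^ 2 * t ^ (2 * H - 2 + 1) := by
        rw [← rpow_natCast, ← rpow_mul ht.le, ← rpow_add ht]
        congr 1
        push_cast
        ring
      rw [e, hab]
      ring
  · refine hconclude (1 / a) _ (by positivity) ?_ ((houter 1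
      (K * b ^ (-(2 * H - 2 + 1))) (fun r _ => abs_sin_le_one _) fun r hr => hK ▸
        abs_integral_sin_mul_abs_sub_rpow_le hβ hβ0 hb hr.1.le hr.2).trans_eq ?_)
    · rw [div_div_eq_mul_div, div_one]
      linarith
    · have e : a * (1 / a) ^ (H + 1/2) = b ^ (-(2 * H - 2 + 1)) := by
        rw [one_div, inv_rpow ha.le, ← rpow_neg ha.le, hab, ← rpow_natCast,
          ← rpow_mul hb.le, ← rpow_add hb]
        congr 1
        push_cast
        ring
      rw [← e]
      ring
end

section
/- Let H ∈ (1/2, 1) and α_H = H(2H−1). There exists a constant D'_H > 0, depending only on H, such that for every t > 0 and every a > 0, the quantity N_t(a) := (α_H / a) ∫₀ᵗ ∫₀ᵗ sin(r√a) · sin(s√a) · |r−s|^{2H−2} dr ds satisfies N_t(a) ≥ D'_H · t · (1/(1/t² + a))^{H+1/2}. -/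
open MeasureTheory Real

lemma integral_sin_mul_exp_neg_mul_abs (l T r : ℝ) (hr : r ∈ Set.Icc 0 T) :
    ∫ s in (0:ℝ)..T, sin s * exp (-(l * |r - s|)) =
      (2 * l * sin r + exp (-(l * r)) - exp (-(l * (T - r))) * (cos T + l * sin T)) /
        (1 + l ^ 2) := by
  have hl : 1 + l ^ 2 ≠ 0 := by positivity
  have hc : Continuous fun s : ℝ => sin s * exp (-(l * |r - s|)) := by fun_prop
  rw [← intervalIntegral.integral_add_adjacent_intervals (hc.intervalIntegrable 0 r)
    (hc.intervalIntegrable r T)]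
  have h1 : ∫ s in (0:ℝ)..r, sin s * exp (-(l * |r - s|)) =
      (l * sin r - cos r + exp (-(l * r))) / (1 + l ^ 2) := by
    have : ∫ s in (0:ℝ)..r, sin s * exp (-(l * |r - s|)) =
        ∫ s in (0:ℝ)..r, sin s * exp (-(l * (r - s))) := by
      refine intervalIntegral.integral_congr fun s hs => ?_
      rw [Set.uIcc_of_le hr.1] at hs
      simp only [abs_of_nonneg (sub_nonneg.2 hs.2)]
    rw [this, intervalIntegral.integral_eq_sub_of_hasDerivAt
      (f := fun s => exp (-(l * (r - s))) * (l * sin s - cos s) / (1 + l ^ 2))]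
    · simp; ring
    · intro s _
      have h := (((((hasDerivAt_id s).const_sub r).const_mul l).neg.exp).mul
        (((hasDerivAt_sin s).const_mul l).sub (hasDerivAt_cos s))).div_const (1 + l ^ 2)
      refine h.congr_deriv ?_
      simp only [id, Pi.sub_apply, Pi.neg_apply]
      field_simp
      ring
    · exact Continuous.intervalIntegrable (by fun_prop) _ _
  have h2 : ∫ s in r..T, sin s * exp (-(l * |r - s|)) =
      (cos r + l * sin r - exp (-(l * (T - r))) * (cos T + l * sin T)) / (1 + l ^ 2) := by
    have : ∫ s in r..T, sin s * exp (-(l * |r - s|)) =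
        ∫ s in r..T, sin s * exp (-(l * (s - r))) := by
      refine intervalIntegral.integral_congr fun s hs => ?_
      rw [Set.uIcc_of_le hr.2] at hs
      simp only [abs_sub_comm r s, abs_of_nonneg (sub_nonneg.2 hs.1)]
    rw [this, intervalIntegral.integral_eq_sub_of_hasDerivAt
      (f := fun s => -(exp (-(l * (s - r))) * (cos s + l * sin s) / (1 + l ^ 2)))]
    · simp; ring
    · intro s _
      have h := ((((((hasDerivAt_id s).sub_const r).const_mul l).neg.exp).mul
        ((hasDerivAt_cos s).add ((hasDerivAt_sin s).const_mul l))).div_const (1 + l ^ 2)).neg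
      refine h.congr_deriv ?_
      simp only [id, Pi.add_apply, Pi.neg_apply]
      field_simp
      ring
    · exact Continuous.intervalIntegrable (by fun_prop) _ _
  rw [h1, h2]
  ring

lemma integral_integral_sin_mul_sin_mul_exp (l T : ℝ) (hT : 0 ≤ T) :
    ∫ r in (0:ℝ)..T, ∫ s in (0:ℝ)..T, sin r * sin s * exp (-(l * |r - s|)) =
      (l * (T - sin T * cos T) + (1 + cos T ^ 2 - l ^ 2 * sin T ^ 2 -
        2 * exp (-(l * T)) * (cos T + l * sin T)) / (1 + l ^ 2)) / (1 + l ^ 2) := by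
  have hl : 1 + l ^ 2 ≠ 0 := by positivity
  have : ∫ r in (0:ℝ)..T, ∫ s in (0:ℝ)..T, sin r * sin s * exp (-(l * |r - s|)) =
      ∫ r in (0:ℝ)..T, sin r * ((2 * l * sin r + exp (-(l * r)) -
        exp (-(l * (T - r))) * (cos T + l * sin T)) / (1 + l ^ 2)) := by
    refine intervalIntegral.integral_congr fun r hr => ?_
    rw [Set.uIcc_of_le hT] at hr
    simp only [mul_assoc (sin r), intervalIntegral.integral_const_mul]
    rw [integral_sin_mul_exp_neg_mul_abs l T r hr]
  rw [this, intervalIntegral.integral_eq_sub_of_hasDerivAt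
    (f := fun r => (l * (r - sin r * cos r) - exp (-(l * r)) * (cos r + l * sin r) / (1 + l ^ 2)
      - (cos T + l * sin T) * (exp (-(l * (T - r))) * (l * sin r - cos r)) / (1 + l ^ 2))
        / (1 + l ^ 2))]
  · simp
    field_simp
    ring
  · intro s _
    have h1 := ((hasDerivAt_id s).sub ((hasDerivAt_sin s).mul (hasDerivAt_cos s))).const_mul l
    have h2 := ((((hasDerivAt_id s).const_mul l).neg.exp).mul
        ((hasDerivAt_cos s).add ((hasDerivAt_sin s).const_mul l))).div_const (1 + l ^ 2)
    have h3 := (((((((hasDerivAt_id s).const_sub T).const_mul l).neg.exp).mul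
        (((hasDerivAt_sin s).const_mul l).sub (hasDerivAt_cos s))).const_mul
          (cos T + l * sin T))).div_const (1 + l ^ 2)
    refine (((h1.sub h2).sub h3).div_const (1 + l ^ 2)).congr_deriv ?_
    have := sin_sq_add_cos_sq s
    simp only [id, Pi.add_apply, Pi.neg_apply, Pi.sub_apply]
    field_simp
    linear_combination (-l * (1 + l ^ 2)) * this
  · exact Continuous.intervalIntegrable (by fun_prop) _ _

lemma integral_integral_sin_mul_sin_mul_exp_nonneg {l T : ℝ} (hl : 0 ≤ l) (hT : 0 ≤ T) :
    0 ≤ ∫ r in (0:ℝ)..T, ∫ s in (0:ℝ)..T, sin r * sin s * exp (-(l * |r - s|)) := by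
  rw [integral_integral_sin_mul_sin_mul_exp l T hT]
  have hl' : 0 < 1 + l ^ 2 := by positivity
  refine div_nonneg ?_ hl'.le
  have hm : Monotone fun x : ℝ => l * (x - sin x * cos x) + (1 + cos x ^ 2 - l ^ 2 * sin x ^ 2 -
        2 * exp (-(l * x)) * (cos x + l * sin x)) / (1 + l ^ 2) -
        (l * sin x - cos x + exp (-(l * x))) ^ 2 / (1 + l ^ 2) := by
    refine monotone_of_hasDerivAt_nonneg
      (f' := fun x => 2 * l * (l * sin x - cos x + exp (-(l * x))) ^ 2 / (1 + l ^ 2)) ?_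
      fun x => by simp only [Pi.zero_apply]; positivity
    intro x
    have hs := hasDerivAt_sin x
    have hc := hasDerivAt_cos x
    have he := ((hasDerivAt_id x).const_mul l).neg.exp
    have h1 := ((hasDerivAt_id x).sub (hs.mul hc)).const_mul l
    have h2 := ((((hc.pow 2).const_add 1).sub ((hs.pow 2).const_mul (l ^ 2))).sub
      ((he.const_mul 2).mul (hc.add (hs.const_mul l)))).div_const (1 + l ^ 2)
    have h3 := ((((hs.const_mul l).sub hc).add he).pow 2).div_const (1 + l ^ 2)
    refine ((h1.add h2).sub h3).congr_deriv ?_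
    have := sin_sq_add_cos_sq x
    simp only [id, Pi.add_apply, Pi.neg_apply, Pi.sub_apply]
    field_simp
    linear_combination (-l * (1 + l ^ 2)) * this
  have h := hm hT
  have : 0 ≤ (l * sin T - cos T + exp (-(l * T))) ^ 2 / (1 + l ^ 2) := by positivity
  norm_num at h
  linarith

lemma le_integral_integral_sin_mul_sin_mul_exp {l T : ℝ} (hl : 8 ≤ l) (hT : 1 ≤ T) :
    l * T / 8 / (1 + l ^ 2) ≤
      ∫ r in (0:ℝ)..T, ∫ s in (0:ℝ)..T, sin r * sin s * exp (-(l * |r - s|)) := by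
  rw [integral_integral_sin_mul_sin_mul_exp l T (by linarith)]
  have hl' : 0 < 1 + l ^ 2 := by positivity
  gcongr
  have hsc := sin_sq_add_cos_sq T
  have h1 : sin T * cos T ≤ 1 / 2 := by nlinarith [sq_nonneg (sin T - cos T)]
  have h2 : exp (-(l * T)) * (cos T + l * sin T) ≤ 1 + l := by
    have : exp (-(l * T)) ≤ 1 := exp_le_one_iff.2 (by nlinarith)
    have h0 := exp_pos (-(l * T))
    have : cos T + l * sin T ≤ 1 + l := by nlinarith [cos_le_one T, sin_le_one T]
    nlinarith
  have h3 : -3 ≤ (1 + cos T ^ 2 - l ^ 2 * sin T ^ 2 -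
        2 * exp (-(l * T)) * (cos T + l * sin T)) / (1 + l ^ 2) := by
    rw [le_div_iff₀ hl']
    have : sin T ^ 2 ≤ 1 := sin_sq_le_one T
    nlinarith [sq_nonneg (cos T), sq_nonneg (l - 1), mul_nonneg (sq_nonneg l) (sub_nonneg.2 this)]
  nlinarith

lemma le_integral_integral_sin_mul_sin_mul_exp_of_le_one {l T : ℝ} (hl : 0 ≤ l) (hT : 0 ≤ T)
    (hT1 : T ≤ 1) (hlT : l * T ≤ 2) :
    exp (-2) * T ^ 4 / 64 ≤
      ∫ r in (0:ℝ)..T, ∫ s in (0:ℝ)..T, sin r * sin s * exp (-(l * |r - s|)) := by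
  have key : ∫ r in (0:ℝ)..T, ∫ s in (0:ℝ)..T, sin r * sin s * exp (-2) ≤
      ∫ r in (0:ℝ)..T, ∫ s in (0:ℝ)..T, sin r * sin s * exp (-(l * |r - s|)) := by
    have hc : Continuous fun p : ℝ × ℝ => sin p.1 * sin p.2 * exp (-(l * |p.1 - p.2|)) := by
      fun_prop
    refine intervalIntegral.integral_mono_on hT ?_ ?_ fun r hr =>
      intervalIntegral.integral_mono_on hT ?_ ?_ fun s hs => ?_
    · simp only [intervalIntegral.integral_mul_const, intervalIntegral.integral_const_mul]
      exact Continuous.intervalIntegrable (by fun_prop) _ _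
    · exact (intervalIntegral.continuous_parametric_intervalIntegral_of_continuous'
        (f := fun r s : ℝ => sin r * sin s * exp (-(l * |r - s|))) hc 0 T).intervalIntegrable _ _
    · exact Continuous.intervalIntegrable (by fun_prop) _ _
    · exact Continuous.intervalIntegrable (by fun_prop) _ _
    · have hr0 := sin_nonneg_of_nonneg_of_le_pi hr.1 (by linarith [hr.2, pi_gt_three])
      have hs0 := sin_nonneg_of_nonneg_of_le_pi hs.1 (by linarith [hs.2, pi_gt_three])
      have : |r - s| ≤ T := abs_le.2 ⟨by linarith [hr.1, hs.2], by linarith [hr.2, hs.1]⟩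
      have : l * |r - s| ≤ 2 := (mul_le_mul_of_nonneg_left this hl).trans hlT
      gcongr
  refine le_trans ?_ key
  simp only [intervalIntegral.integral_mul_const, intervalIntegral.integral_const_mul, integral_sin,
    cos_zero]
  have h : T ^ 2 / 8 ≤ 1 - cos T := by
    have h1 := mul_le_sin (x := T / 2) (by linarith) (by linarith [pi_gt_three])
    have h2 : T / 4 ≤ sin (T / 2) := by
      have : 1 / 2 ≤ 2 / π := (div_le_div_iff₀ two_pos pi_pos).2 (by linarith [pi_lt_four])
      nlinarith
    have h3 := cos_sq' (T / 2)
    have h4 := cos_sq (T / 2)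
    rw [mul_div_cancel₀ T (two_ne_zero)] at h4
    nlinarith [mul_self_le_mul_self (by positivity) h2]
  have : (T ^ 2 / 8) ^ 2 ≤ (1 - cos T) ^ 2 := by gcongr
  nlinarith [exp_pos (-2)]

lemma integrable_exp_neg_mul_abs {l : ℝ} (hl : 0 < l) :
    Integrable fun x : ℝ => exp (-(l * |x|)) := by
  have h : IntegrableOn (fun x : ℝ => exp (-(l * |x|))) (Set.Ioi 0) :=
    (exp_neg_integrableOn_Ioi 0 hl).congr_fun
      (fun x hx => by simp only [abs_of_pos (Set.mem_Ioi.1 hx), neg_mul]) measurableSet_Ioi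
  rw [← integrableOn_univ, ← Set.Iic_union_Ioi (a := (0 : ℝ)), integrableOn_union]
  refine ⟨?_, h⟩
  rw [← integrableOn_Ici_iff_integrableOn_Ioi] at h
  have := h.comp_neg
  simpa using this

lemma integral_exp_neg_mul_abs {l : ℝ} (hl : 0 < l) :
    ∫ x : ℝ, exp (-(l * |x|)) = 2 / l := by
  rw [integral_comp_abs (f := fun x => exp (-(l * x)))]
  have := integral_exp_mul_Ioi (neg_lt_zero.2 hl) 0
  simp only [neg_mul, mul_zero, exp_zero] at this
  rw [this]
  field_simp

lemma integral_rpow_mul_exp_neg_mul_abs {b : ℝ} (hb : -1 < b) (x : ℝ) :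
    ∫ l in Set.Ioi (0 : ℝ), l ^ b * exp (-(l * |x|)) = Gamma (b + 1) * |x| ^ (-(b + 1)) := by
  rcases eq_or_ne x 0 with rfl | hx
  · simp only [abs_zero, mul_zero, neg_zero, exp_zero, mul_one]
    rw [zero_rpow (by linarith), mul_zero]
    exact integral_undef (not_integrableOn_Ioi_rpow b)
  · have h := integral_rpow_mul_exp_neg_mul_Ioi (a := b + 1) (by linarith) (abs_pos.2 hx)
    rw [one_div, inv_rpow (abs_nonneg x), ← rpow_neg (abs_nonneg x)] at h
    simp only [add_sub_cancel_right] at h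
    rw [mul_comm, ← h]
    simp only [mul_comm]

lemma integrable_sin_mul_sin_mul_rpow_mul_exp {b T : ℝ} (hb : -1 < b) (hb0 : b < 0) (hT : 0 ≤ T) :
    Integrable (fun q : (ℝ × ℝ) × ℝ =>
      sin q.1.1 * sin q.1.2 * (q.2 ^ b * exp (-(q.2 * |q.1.1 - q.1.2|))))
      (((volume.restrict (Set.Ioc 0 T)).prod (volume.restrict (Set.Ioc 0 T))).prod
        (volume.restrict (Set.Ioi 0))) := by
  have hm : Measurable (fun q : (ℝ × ℝ) × ℝ =>
      sin q.1.1 * sin q.1.2 * (q.2 ^ b * exp (-(q.2 * |q.1.1 - q.1.2|)))) := by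
    fun_prop
  have hexp : ∀ l : ℝ, 0 < l → Integrable (fun p : ℝ × ℝ => exp (-(l * |p.1 - p.2|)))
      ((volume.restrict (Set.Ioc 0 T)).prod (volume.restrict (Set.Ioc 0 T))) := by
    intro l hl
    refine Integrable.of_bound (C := 1) (by fun_prop) (ae_of_all _ fun p => ?_)
    rw [norm_of_nonneg (exp_nonneg _), exp_le_one_iff]
    exact neg_nonpos.2 (by positivity)
  have hle : ∀ l : ℝ, 0 < l → ∀ p : ℝ × ℝ,
      ‖sin p.1 * sin p.2 * (l ^ b * exp (-(l * |p.1 - p.2|)))‖ ≤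
        l ^ b * exp (-(l * |p.1 - p.2|)) := by
    intro l hl p
    have : 0 ≤ l ^ b * exp (-(l * |p.1 - p.2|)) := by positivity
    rw [norm_mul, norm_mul, norm_of_nonneg this]
    refine mul_le_of_le_one_left this ?_
    exact mul_le_one₀ (abs_sin_le_one _) (norm_nonneg _) (abs_sin_le_one _)
  have hint : ∀ l : ℝ, 0 < l → Integrable (fun p : ℝ × ℝ =>
      sin p.1 * sin p.2 * (l ^ b * exp (-(l * |p.1 - p.2|))))
      ((volume.restrict (Set.Ioc 0 T)).prod (volume.restrict (Set.Ioc 0 T))) := fun l hl =>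
    ((hexp l hl).const_mul (l ^ b)).mono' (by fun_prop) (ae_of_all _ (hle l hl))
  rw [integrable_prod_iff' hm.aestronglyMeasurable]
  refine ⟨(ae_restrict_iff' measurableSet_Ioi).2 (ae_of_all _ hint), ?_⟩
  have hm' : AEStronglyMeasurable (fun l : ℝ => ∫ p : ℝ × ℝ,
      ‖sin p.1 * sin p.2 * (l ^ b * exp (-(l * |p.1 - p.2|)))‖
        ∂((volume.restrict (Set.Ioc 0 T)).prod (volume.restrict (Set.Ioc 0 T)))) volume :=
    (StronglyMeasurable.integral_prod_left' hm.norm.stronglyMeasurable).aestronglyMeasurable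
  have hle' : ∀ l : ℝ, 0 < l → ∫ p : ℝ × ℝ,
      ‖sin p.1 * sin p.2 * (l ^ b * exp (-(l * |p.1 - p.2|)))‖
        ∂((volume.restrict (Set.Ioc 0 T)).prod (volume.restrict (Set.Ioc 0 T))) ≤
      l ^ b * ∫ p : ℝ × ℝ, exp (-(l * |p.1 - p.2|))
        ∂((volume.restrict (Set.Ioc 0 T)).prod (volume.restrict (Set.Ioc 0 T))) := by
    intro l hl
    rw [← integral_const_mul]
    exact integral_mono (hint l hl).norm ((hexp l hl).const_mul _) (hle l hl)
  rw [← Set.Ioc_union_Ioi_eq_Ioi zero_le_one]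
  refine IntegrableOn.union ?_ ?_
  · refine Integrable.mono' (g := fun l => l ^ b * T ^ 2) ?_ hm'.restrict
      ((ae_restrict_iff' measurableSet_Ioc).2 (ae_of_all _ fun l hl => ?_))
    · exact (((intervalIntegrable_iff_integrableOn_Ioc_of_le zero_le_one).1
        (intervalIntegral.intervalIntegrable_rpow' hb))).mul_const _
    · rw [norm_of_nonneg (integral_nonneg fun _ => norm_nonneg _)]
      refine (hle' l hl.1).trans ?_
      have hl0 := hl.1
      gcongr
      refine (integral_mono (hexp l hl.1) (integrable_const 1) fun p => ?_).trans ?_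
      · exact exp_le_one_iff.2 (neg_nonpos.2 (by positivity))
      · simp [measureReal_def, ← Set.univ_prod_univ, Measure.prod_prod, hT, sq]
  · refine Integrable.mono' (g := fun l => l ^ (b - 1) * (2 * T)) ?_ hm'.restrict
      ((ae_restrict_iff' measurableSet_Ioi).2 (ae_of_all _ fun l hl => ?_))
    · exact (integrableOn_Ioi_rpow_of_lt (by linarith) one_pos).mul_const _
    · have hl0 : 0 < l := one_pos.trans hl
      rw [norm_of_nonneg (integral_nonneg fun _ => norm_nonneg _)]
      refine (hle' l hl0).trans ?_
      rw [rpow_sub_one hl0.ne', div_mul_eq_mul_div, mul_div_assoc]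
      gcongr
      rw [integral_prod _ (hexp l hl0)]
      refine (integral_mono (g := fun _ => 2 / l) (hexp l hl0).integral_prod_left
        (integrable_const _) fun r => ?_).trans ?_
      · have hi : Integrable (fun s => exp (-(l * |r - s|))) :=
          (integrable_exp_neg_mul_abs hl0).comp_sub_left r
        refine (setIntegral_le_integral hi (ae_of_all _ fun s => exp_nonneg _)).trans ?_
        rw [integral_sub_left_eq_self (fun x => exp (-(l * |x|))), integral_exp_neg_mul_abs hl0]
      · simp [hT]
        exact le_of_eq (by ring)

lemma integral_prod_sin_mul_sin_mul_rpow_mul_exp {b T l : ℝ} (hT : 0 ≤ T) :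
    ∫ p : ℝ × ℝ, sin p.1 * sin p.2 * (l ^ b * exp (-(l * |p.1 - p.2|)))
        ∂((volume.restrict (Set.Ioc 0 T)).prod (volume.restrict (Set.Ioc 0 T))) =
      l ^ b * ∫ r in (0:ℝ)..T, ∫ s in (0:ℝ)..T, sin r * sin s * exp (-(l * |r - s|)) := by
  have hc : Integrable (fun p : ℝ × ℝ => sin p.1 * sin p.2 * (l ^ b * exp (-(l * |p.1 - p.2|))))
      ((volume.restrict (Set.Ioc 0 T)).prod (volume.restrict (Set.Ioc 0 T))) := by
    rw [Measure.prod_restrict]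
    refine IntegrableOn.mono_set (t := Set.Icc 0 T ×ˢ Set.Icc 0 T) ?_
      (Set.prod_mono Set.Ioc_subset_Icc_self Set.Ioc_subset_Icc_self)
    exact Continuous.continuousOn (by fun_prop) |>.integrableOn_compact
      (isCompact_Icc.prod isCompact_Icc)
  rw [integral_prod _ hc]
  simp only [intervalIntegral.integral_of_le hT, ← integral_const_mul, mul_left_comm (l ^ b)]

/-- The Riesz kernel is a mixture of exponential kernels; here both sides are integrated against
`sin r * sin s`. -/
lemma gamma_mul_integral_integral_sin_mul_sin_mul_rpow {b T : ℝ} (hb : -1 < b) (hb0 : b < 0)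
    (hT : 0 ≤ T) :
    Gamma (b + 1) * ∫ r in (0:ℝ)..T, ∫ s in (0:ℝ)..T, sin r * sin s * |r - s| ^ (-(b + 1)) =
      ∫ l in Set.Ioi (0:ℝ), l ^ b *
        ∫ r in (0:ℝ)..T, ∫ s in (0:ℝ)..T, sin r * sin s * exp (-(l * |r - s|)) := by
  have hF := integrable_sin_mul_sin_mul_rpow_mul_exp hb hb0 hT
  have hswap := integral_integral_swap (f := fun (p : ℝ × ℝ) (l : ℝ) =>
    sin p.1 * sin p.2 * (l ^ b * exp (-(l * |p.1 - p.2|)))) hF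
  rw [integral_prod _ hF.integral_prod_left] at hswap
  simp only [integral_const_mul, integral_rpow_mul_exp_neg_mul_abs hb,
    integral_prod_sin_mul_sin_mul_rpow_mul_exp hT] at hswap
  rw [← hswap]
  simp only [intervalIntegral.integral_of_le hT, ← integral_const_mul, mul_left_comm (Gamma _)]

lemma integrableOn_rpow_mul_integral_integral_sin_mul_sin_mul_exp {b T : ℝ} (hb : -1 < b)
    (hb0 : b < 0) (hT : 0 ≤ T) :
    IntegrableOn (fun l : ℝ => l ^ b *
      ∫ r in (0:ℝ)..T, ∫ s in (0:ℝ)..T, sin r * sin s * exp (-(l * |r - s|))) (Set.Ioi 0) := by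
  have := (integrable_sin_mul_sin_mul_rpow_mul_exp hb hb0 hT).integral_prod_right
  simpa only [IntegrableOn, integral_prod_sin_mul_sin_mul_rpow_mul_exp hT] using this

lemma mul_le_gamma_mul_integral_integral {b T A B m : ℝ} (hb : -1 < b) (hb0 : b < 0) (hT : 0 ≤ T)
    (hA : 0 < A) (hAB : A ≤ B) (hm0 : 0 ≤ m)
    (hm : ∀ l ∈ Set.Ioc A B,
      m ≤ ∫ r in (0:ℝ)..T, ∫ s in (0:ℝ)..T, sin r * sin s * exp (-(l * |r - s|))) :
    (B - A) * (B ^ b * m) ≤ Gamma (b + 1) *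
      ∫ r in (0:ℝ)..T, ∫ s in (0:ℝ)..T, sin r * sin s * |r - s| ^ (-(b + 1)) := by
  have hi := integrableOn_rpow_mul_integral_integral_sin_mul_sin_mul_exp hb hb0 hT
  have hsub : Set.Ioc A B ⊆ Set.Ioi 0 := fun l hl => hA.trans hl.1
  rw [gamma_mul_integral_integral_sin_mul_sin_mul_rpow hb hb0 hT]
  calc (B - A) * (B ^ b * m) = ∫ _ in Set.Ioc A B, B ^ b * m := by
        simp [measureReal_def, hAB]
    _ ≤ ∫ l in Set.Ioc A B, l ^ b *
        ∫ r in (0:ℝ)..T, ∫ s in (0:ℝ)..T, sin r * sin s * exp (-(l * |r - s|)) := by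
        refine setIntegral_mono_on (integrable_const _) (hi.mono_set hsub) measurableSet_Ioc
          fun l hl => ?_
        exact mul_le_mul (rpow_le_rpow_of_nonpos (hsub hl) hl.2 hb0.le) (hm l hl) hm0
          (rpow_nonneg (hsub hl).le _)
    _ ≤ _ := by
        refine setIntegral_mono_set hi ((ae_restrict_iff' measurableSet_Ioi).2
          (ae_of_all _ fun l hl => ?_)) (ae_of_all _ hsub)
        exact mul_nonneg (rpow_nonneg (Set.mem_Ioi.1 hl).le _)
          (integral_integral_sin_mul_sin_mul_exp_nonneg (Set.mem_Ioi.1 hl).le hT)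

lemma exists_mul_le_integral_integral_sin_mul_sin_mul_rpow {H : ℝ} (hH : 1 / 2 < H)
    (hH1 : H < 1) :
    ∃ c : ℝ, 0 < c ∧ ∀ T : ℝ, 0 < T → c * (T ^ (2 * H + 2) / (1 + T ^ 2) ^ (H + 1 / 2)) ≤
      ∫ r in (0:ℝ)..T, ∫ s in (0:ℝ)..T, sin r * sin s * |r - s| ^ (2 * H - 2) := by
  have hb : -1 < 1 - 2 * H := by linarith
  have hb0 : 1 - 2 * H < 0 := by linarith
  have hG : 0 < Gamma (1 - 2 * H + 1) := Gamma_pos_of_pos (by linarith)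
  have hexp : -(1 - 2 * H + 1) = 2 * H - 2 := by ring
  have h2 : 0 < (2 : ℝ) ^ (1 - 2 * H) * (exp (-2) / 64) := by positivity
  have h9 : 0 < (9 : ℝ) ^ (1 - 2 * H) / 82 := by positivity
  refine ⟨min ((2 : ℝ) ^ (1 - 2 * H) * (exp (-2) / 64)) ((9 : ℝ) ^ (1 - 2 * H) / 82) /
    Gamma (1 - 2 * H + 1), div_pos (lt_min h2 h9) hG, fun T hT => ?_⟩
  rw [div_mul_eq_mul_div, div_le_iff₀' hG]
  rcases le_total T 1 with hT1 | hT1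
  · have h := mul_le_gamma_mul_integral_integral (A := 1 / T) (B := 2 / T)
      (m := exp (-2) * T ^ 4 / 64) hb hb0 hT.le (by positivity) (by gcongr; norm_num)
      (by positivity) fun l hl =>
        le_integral_integral_sin_mul_sin_mul_exp_of_le_one
          ((by positivity : 0 ≤ 1 / T).trans hl.1.le) hT.le hT1 ((le_div_iff₀ hT).1 hl.2)
    rw [hexp] at h
    refine le_trans ?_ h
    have hle : T ^ (2 * H + 2) / (1 + T ^ 2) ^ (H + 1 / 2) ≤ T ^ (2 * H + 2) :=
      div_le_self (by positivity)
        (one_le_rpow (by linarith [sq_nonneg T]) (by linarith))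
    have hpow : T ^ (2 * H + 2) = T ^ 3 / T ^ (1 - 2 * H) := by
      rw [← rpow_natCast, ← rpow_sub hT]
      congr 1
      push_cast
      ring
    calc _ ≤ (2 : ℝ) ^ (1 - 2 * H) * (exp (-2) / 64) * T ^ (2 * H + 2) :=
          mul_le_mul (min_le_left _ _) hle (by positivity) h2.le
      _ = _ := by
          rw [hpow, div_rpow zero_le_two hT.le]
          field_simp
          ring
  · have h := mul_le_gamma_mul_integral_integral (A := 8) (B := 9)
      (m := T / 82) hb hb0 hT.le (by norm_num) (by norm_num) (by positivity) fun l hl => by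
        refine le_trans ?_ (le_integral_integral_sin_mul_sin_mul_exp hl.1.le hT1)
        have := hl.1
        have := hl.2
        gcongr
        · nlinarith
        · nlinarith
    rw [hexp] at h
    refine le_trans ?_ h
    have hle : T ^ (2 * H + 2) / (1 + T ^ 2) ^ (H + 1 / 2) ≤ T := by
      rw [div_le_iff₀ (by positivity)]
      calc T ^ (2 * H + 2) = T * (T ^ 2) ^ (H + 1 / 2) := by
            rw [← rpow_natCast T 2, ← rpow_mul hT.le, ← rpow_one_add' hT.le]
            · congr 1
              push_cast
              ring
            · push_cast
              linarith
        _ ≤ T * (1 + T ^ 2) ^ (H + 1 / 2) := by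
            gcongr
            linarith
    calc _ ≤ (9 : ℝ) ^ (1 - 2 * H) / 82 * T :=
          mul_le_mul (min_le_right _ _) hle (by positivity) h9.le
      _ = _ := by ring

lemma integral_integral_sin_mul_sin_mul_rpow_comp_mul_right {w : ℝ} (hw : 0 < w) (t β : ℝ) :
    ∫ r in (0:ℝ)..t, ∫ s in (0:ℝ)..t, sin (r * w) * sin (s * w) * |r - s| ^ β =
      (w ^ (β + 2))⁻¹ *
        ∫ r in (0:ℝ)..t * w, ∫ s in (0:ℝ)..t * w, sin r * sin s * |r - s| ^ β := by
  have h : ∀ r s : ℝ, sin (r * w) * sin (s * w) * |r - s| ^ β =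
      (w ^ β)⁻¹ * (sin (r * w) * sin (s * w) * |r * w - s * w| ^ β) := by
    intro r s
    rw [← sub_mul, abs_mul, abs_of_pos hw, mul_rpow (abs_nonneg _) hw.le]
    field_simp
  simp only [h, intervalIntegral.integral_const_mul]
  have h1 : ∀ r : ℝ, ∫ s in (0:ℝ)..t, sin (r * w) * sin (s * w) * |r * w - s * w| ^ β =
      w⁻¹ * ∫ s in (0:ℝ)..t * w, sin (r * w) * sin s * |r * w - s| ^ β := by
    intro r
    have := intervalIntegral.integral_comp_mul_right (a := 0) (b := t)
      (fun s => sin (r * w) * sin s * |r * w - s| ^ β) hw.ne'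
    simpa using this
  have h2 := intervalIntegral.integral_comp_mul_right (a := 0) (b := t)
      (fun r => ∫ s in (0:ℝ)..t * w, sin r * sin s * |r - s| ^ β) hw.ne'
  simp only [h1, intervalIntegral.integral_const_mul, h2, zero_mul, smul_eq_mul]
  rw [rpow_add hw, rpow_two]
  field_simp

/-- Lower bound of Theorem 4.3: for `H ∈ (1/2,1)` and `α_H = H(2H-1)`, there is a constant
`D'_H > 0` such that for all `t > 0` and `a > 0`,
`N_t(a) = (α_H/a) ∫₀ᵗ∫₀ᵗ sin(r√a) sin(s√a) |r-s|^{2H-2} dr ds`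
satisfies `N_t(a) ≥ D'_H · t · (1/(1/t² + a))^{H+1/2}`. -/
theorem hyperbolic_Nt_lower_bound (H : ℝ) (hH : 1/2 < H) (hH1 : H < 1) :
    ∃ D : ℝ, 0 < D ∧
      ∀ t : ℝ, 0 < t → ∀ a : ℝ, 0 < a →
        D * t * (1 / (1/t^2 + a)) ^ (H + 1/2) ≤
          (H * (2*H - 1) / a) *
            ∫ r in (0:ℝ)..t, ∫ s in (0:ℝ)..t,
              Real.sin (r * Real.sqrt a) * Real.sin (s * Real.sqrt a) *
                |r - s| ^ (2*H - 2) := by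
  obtain ⟨c, hc, h⟩ := exists_mul_le_integral_integral_sin_mul_sin_mul_rpow hH hH1
  have hα : 0 < H * (2 * H - 1) := mul_pos (by linarith) (by linarith)
  refine ⟨H * (2 * H - 1) * c, mul_pos hα hc, fun t ht a ha => ?_⟩
  have hw : 0 < √a := sqrt_pos.2 ha
  rw [integral_integral_sin_mul_sin_mul_rpow_comp_mul_right hw]
  refine le_trans (le_of_eq ?_) (mul_le_mul_of_nonneg_left
    (mul_le_mul_of_nonneg_left (h (t * √a) (by positivity)) (by positivity)) (by positivity))
  have h1 : 1 / (1 / t ^ 2 + a) = t ^ 2 / (1 + (t * √a) ^ 2) := by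
    rw [mul_pow, sq_sqrt ha.le]
    field_simp
  have h2 : (t ^ 2) ^ (H + 1 / 2) = t ^ (2 * H + 1) := by
    rw [← rpow_natCast t 2, ← rpow_mul ht.le]
    congr 1
    push_cast
    ring
  have h3 : √a ^ (2 * H + 2) = √a ^ (2 * H - 2 + 2) * a := by
    rw [show 2 * H + 2 = 2 * H - 2 + 2 + 2 by ring, rpow_add hw (2 * H - 2 + 2), rpow_two,
      sq_sqrt ha.le]
  have h4 : t ^ (2 * H + 2) = t ^ (2 * H + 1) * t := by
    rw [← rpow_add_one ht.ne']
    congr 1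
    ring
  rw [h1, div_rpow (by positivity) (by positivity), h2, mul_rpow ht.le hw.le, h3, h4]
  field_simp
end

section
/- Let H ∈ (1/2, 1) and α_H = H(2H−1). There exists a constant c_H > 0, depending only on H, such that for all T > 0 and all a, b ∈ ℝ: α_H ∫₀ᵀ ∫₀ᵀ e^{−(r+s)a} · cos((r−s)b) · |r−s|^{2H−2} dr ds = c_H ∫_ℝ [ sin²((τ+b)T) + (e^{−aT} − cos((τ+b)T))² ] / (a² + (τ+b)²) · |τ|^{−(2H−1)} dτ. -/
open MeasureTheory Real

theorem integral_integral_swap_of_nonneg {α β : Type*} [MeasurableSpace α] [MeasurableSpace β]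
    {μ : Measure α} {ν : Measure β} [SFinite μ] [SFinite ν] {f : α → β → ℝ}
    (hf : AEStronglyMeasurable (Function.uncurry f) (μ.prod ν)) (h0 : ∀ x y, 0 ≤ f x y)
    (hx : ∀ᵐ x ∂μ, Integrable (f x) ν) (hy : ∀ᵐ y ∂ν, Integrable (fun x => f x y) μ) :
    ∫ x, ∫ y, f x y ∂ν ∂μ = ∫ y, ∫ x, f x y ∂μ ∂ν := by
  by_cases h : Integrable (Function.uncurry f) (μ.prod ν)
  · exact integral_integral_swap h
  · have hn : ∀ x y, ‖f x y‖ = f x y := fun x y => Real.norm_of_nonneg (h0 x y)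
    have h1 := mt (fun h' => (integrable_prod_iff hf).2 ⟨hx, h'⟩) h
    have h2 := mt (fun h' => (integrable_prod_iff' hf).2 ⟨hy, h'⟩) h
    simp only [Function.uncurry_apply_pair, hn] at h1 h2
    rw [integral_undef h1, integral_undef h2]

theorem abs_rpow_eq_sq_rpow (x s : ℝ) : |x| ^ (2 * s) = (x ^ 2) ^ s := by
  rw [Real.rpow_mul (abs_nonneg x), Real.rpow_two, sq_abs]

theorem integral_rpow_mul_exp_neg_mul_sq_Ioi {H : ℝ} (hH : 1/2 < H) (τ : ℝ) :
    ∫ u in Set.Ioi (0:ℝ), u ^ (H - 3/2) * Real.exp (-(u * τ ^ 2)) =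
      Real.Gamma (H - 1/2) * |τ| ^ (-(2 * H - 1)) := by
  rcases eq_or_ne τ 0 with rfl | hτ
  · simp [setIntegral_Ioi_zero_rpow, Real.zero_rpow (show (1 - 2 * H) ≠ 0 by linarith)]
  · have h := Real.integral_rpow_mul_exp_neg_mul_Ioi (a := H - 1/2) (r := τ ^ 2)
      (by linarith) (by positivity)
    rw [show -(2 * H - 1) = 2 * (-(H - 1/2)) by ring, abs_rpow_eq_sq_rpow,
      Real.rpow_neg (by positivity), mul_comm, ← Real.inv_rpow (by positivity), ← one_div, ← h]
    simp only [mul_comm, show H - 1/2 - 1 = H - 3/2 by ring]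

theorem integral_rpow_mul_exp_neg_sq_div_Ioi {H : ℝ} (hH1 : H < 1) (x : ℝ) :
    ∫ u in Set.Ioi (0:ℝ), u ^ (H - 2) * Real.exp (-(x ^ 2 / (4 * u))) =
      4 ^ (1 - H) * Real.Gamma (1 - H) * |x| ^ (2 * H - 2) := by
  rcases eq_or_ne x 0 with rfl | hx
  · simp [setIntegral_Ioi_zero_rpow, Real.zero_rpow (show 2 * H - 2 ≠ 0 by linarith)]
  · have h := Real.integral_rpow_mul_exp_neg_mul_Ioi (a := 1 - H) (r := x ^ 2 / 4)
      (by linarith) (by positivity)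
    rw [← integral_comp_rpow_Ioi _ (show (-1 : ℝ) ≠ 0 by norm_num)] at h
    rw [show 2 * H - 2 = 2 * (-(1 - H)) by ring, abs_rpow_eq_sq_rpow,
      Real.rpow_neg (by positivity), ← Real.inv_rpow (by positivity)]
    rw [one_div, inv_div, div_eq_mul_inv 4, Real.mul_rpow (by norm_num) (by positivity)] at h
    rw [mul_right_comm, ← h]
    refine setIntegral_congr_fun measurableSet_Ioi fun u (hu : 0 < u) => ?_
    have e : u ^ (H - 2) = u ^ (-1 - 1 : ℝ) * (u ^ (-1 : ℝ)) ^ (1 - H - 1) := by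
      rw [← Real.rpow_mul hu.le, ← Real.rpow_add hu]
      ring_nf
    simp only [smul_eq_mul, abs_neg, abs_one, one_mul]
    rw [e, ← mul_assoc, Real.rpow_neg_one]
    congr 2
    field_simp

theorem integral_exp_neg_mul_sq_mul_cos {u : ℝ} (hu : 0 < u) (x b : ℝ) :
    ∫ τ : ℝ, Real.exp (-(u * τ ^ 2)) * Real.cos (x * (τ + b)) =
      √(π / u) * Real.exp (-(x ^ 2 / (4 * u))) * Real.cos (x * b) := by
  have h := fourierIntegral_gaussian (b := (u : ℂ)) (by simpa using hu) (x : ℂ)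
  have h2 := congrArg (fun z => (Complex.exp (Complex.I * (x * b)) * z).re) h
  simp only [← integral_const_mul] at h2
  have hint : Integrable (fun τ : ℝ => Complex.exp (Complex.I * (x * b)) *
      (Complex.exp (Complex.I * x * τ) * Complex.exp (-u * τ ^ 2))) := by
    refine Integrable.mono' (integrable_exp_neg_mul_sq hu) (by fun_prop) (ae_of_all _ fun τ => ?_)
    rw [norm_mul, norm_mul, Complex.norm_exp, Complex.norm_exp, Complex.norm_exp]
    simp [← Complex.ofReal_pow]
  have h3 := integral_re hint
  simp only [RCLike.re_eq_complex_re] at h3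
  rw [← h3] at h2
  have hs : ((π : ℂ) / u) ^ (1 / 2 : ℂ) = ((√(π / u) : ℝ) : ℂ) := by
    rw [Real.sqrt_eq_rpow, Complex.ofReal_cpow (by positivity)]
    push_cast
    rfl
  rw [hs] at h2
  convert h2 using 1
  · refine integral_congr_ae (ae_of_all _ fun τ => ?_)
    simp only
    rw [← Complex.exp_add, ← Complex.exp_add, Complex.exp_re]
    simp [← Complex.ofReal_pow]
    ring_nf
  · rw [mul_left_comm, ← Complex.exp_add, Complex.re_ofReal_mul, Complex.exp_re]
    have : Complex.I * (↑x * ↑b) + -(x:ℂ) ^ 2 / (4 * ↑u) =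
      ((-(x ^ 2 / (4 * u)) : ℝ) : ℂ) + ((x * b : ℝ) : ℂ) * Complex.I := by
      push_cast; ring
    rw [this]
    simp only [Complex.add_re, Complex.add_im, Complex.ofReal_re, Complex.ofReal_im,
      Complex.re_ofReal_mul, Complex.im_ofReal_mul, Complex.I_re, Complex.I_im, mul_zero, mul_one,
      add_zero, zero_add]
    ring

theorem integral_mul_cos_mul_abs_rpow_eq_spectral {α : Type*} [MeasurableSpace α]
    {P : Measure α} [SFinite P] {H : ℝ} (hH : 1/2 < H) (hH1 : H < 1) {x w : α → ℝ}
    (hx : Measurable x) (hx0 : ∀ᵐ p ∂P, x p ≠ 0) (hw : Integrable w P)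
    (hwx : Integrable (fun p => w p * |x p| ^ (2 * H - 2)) P) (b : ℝ)
    (hK : ∀ τ, 0 ≤ ∫ p, w p * Real.cos (x p * (τ + b)) ∂P) :
    4 ^ (1 - H) * Real.Gamma (1 - H) *
        ∫ p, w p * Real.cos (x p * b) * |x p| ^ (2 * H - 2) ∂P =
      Real.Gamma (H - 1/2) / √π *
        ∫ τ, (∫ p, w p * Real.cos (x p * (τ + b)) ∂P) * |τ| ^ (-(2 * H - 1)) := by
  have hG : 0 < Real.Gamma (1 - H) := Real.Gamma_pos_of_pos (by linarith)
  have hG2 : 0 < Real.Gamma (H - 1/2) := Real.Gamma_pos_of_pos (by linarith)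
  have hint1 : Integrable (Function.uncurry fun (p : α) (u : ℝ) =>
      w p * Real.cos (x p * b) * (u ^ (H - 2) * Real.exp (-(x p ^ 2 / (4 * u)))))
      (P.prod (volume.restrict (Set.Ioi 0))) := by
    have hm : AEStronglyMeasurable (Function.uncurry fun (p : α) (u : ℝ) =>
        w p * Real.cos (x p * b) * (u ^ (H - 2) * Real.exp (-(x p ^ 2 / (4 * u)))))
        (P.prod (volume.restrict (Set.Ioi 0))) := by
      have h1 : AEStronglyMeasurable (fun z : α × ℝ => w z.1)
          (P.prod (volume.restrict (Set.Ioi 0))) := hw.aestronglyMeasurable.comp_fst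
      have h2 : Measurable (fun z : α × ℝ => Real.cos (x z.1 * b)) := by fun_prop
      have h3 : Measurable (fun z : α × ℝ =>
        z.2 ^ (H - 2) * Real.exp (-(x z.1 ^ 2 / (4 * z.2)))) := by fun_prop
      exact (h1.mul h2.aestronglyMeasurable).mul h3.aestronglyMeasurable
    rw [integrable_prod_iff hm]
    constructor
    · filter_upwards [hx0] with p hp
      have hpos := Real.rpow_pos_of_pos (abs_pos.2 hp) (2 * H - 2)
      have h : IntegrableOn (fun u : ℝ => u ^ (H - 2) * Real.exp (-(x p ^ 2 / (4 * u))))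
          (Set.Ioi 0) := by
        refine Integrable.of_integral_ne_zero ?_
        rw [integral_rpow_mul_exp_neg_sq_div_Ioi hH1]
        positivity
      exact h.const_mul (w p * Real.cos (x p * b))
    · have hmx : Measurable fun p => Real.cos (x p * b) := by fun_prop
      have h1 : Integrable (fun p => Real.cos (x p * b) * (w p * |x p| ^ (2 * H - 2))) P :=
        hwx.bdd_mul (c := 1) hmx.aestronglyMeasurable
          (ae_of_all _ fun p => by simpa using Real.abs_cos_le_one _)
      refine (h1.norm.const_mul (4 ^ (1 - H) * Real.Gamma (1 - H))).congr
        (ae_of_all _ fun p => ?_)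
      have e : ∫ u in Set.Ioi (0:ℝ),
          ‖w p * Real.cos (x p * b) * (u ^ (H - 2) * Real.exp (-(x p ^ 2 / (4 * u))))‖ =
          ∫ u in Set.Ioi (0:ℝ),
            |w p * Real.cos (x p * b)| * (u ^ (H - 2) * Real.exp (-(x p ^ 2 / (4 * u)))) := by
        refine setIntegral_congr_fun measurableSet_Ioi fun u (hu : 0 < u) => ?_
        rw [norm_mul, Real.norm_eq_abs, Real.norm_of_nonneg (by positivity)]
      simp only [Function.uncurry_apply_pair]
      rw [e, integral_const_mul, integral_rpow_mul_exp_neg_sq_div_Ioi hH1, Real.norm_eq_abs,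
        abs_mul, abs_mul, abs_mul, abs_of_nonneg (Real.rpow_nonneg (abs_nonneg (x p)) _)]
      ring
  have hint2 : ∀ u : ℝ, 0 < u → Integrable (Function.uncurry fun (p : α) (τ : ℝ) =>
      w p * (Real.exp (-(u * τ ^ 2)) * Real.cos (x p * (τ + b)))) (P.prod volume) := by
    intro u hu
    have h1 : Integrable (fun z : α × ℝ => w z.1 * Real.exp (-u * z.2 ^ 2)) (P.prod volume) :=
      hw.mul_prod (integrable_exp_neg_mul_sq hu)
    have hmx : Measurable fun z : α × ℝ => Real.cos (x z.1 * (z.2 + b)) := by fun_prop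
    refine (h1.bdd_mul (c := 1) hmx.aestronglyMeasurable
      (ae_of_all _ fun p => by simpa using Real.abs_cos_le_one _)).congr (ae_of_all _ fun z => ?_)
    simp only [Function.uncurry]
    ring_nf
  have hKm : AEStronglyMeasurable (fun τ => ∫ p, w p * Real.cos (x p * (τ + b)) ∂P) volume := by
    have h1 : AEStronglyMeasurable (fun z : ℝ × α => w z.2) (volume.prod P) :=
      hw.aestronglyMeasurable.comp_snd
    have h2 : Measurable (fun z : ℝ × α => Real.cos (x z.2 * (z.1 + b))) := by fun_prop
    exact (h1.mul h2.aestronglyMeasurable).integral_prod_right'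
  set K : ℝ → ℝ := fun τ => ∫ p, w p * Real.cos (x p * (τ + b)) ∂P with hKdef
  calc
    _ = ∫ p, (∫ u in Set.Ioi (0:ℝ),
          w p * Real.cos (x p * b) * (u ^ (H - 2) * Real.exp (-(x p ^ 2 / (4 * u))))) ∂P := by
        rw [← integral_const_mul]
        refine integral_congr_ae (ae_of_all _ fun p => ?_)
        simp only
        rw [integral_const_mul, integral_rpow_mul_exp_neg_sq_div_Ioi hH1]
        ring
    _ = ∫ u in Set.Ioi (0:ℝ), (∫ p,
          w p * Real.cos (x p * b) * (u ^ (H - 2) * Real.exp (-(x p ^ 2 / (4 * u)))) ∂P) :=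
        integral_integral_swap hint1
    _ = ∫ u in Set.Ioi (0:ℝ), (√π)⁻¹ *
          ∫ τ, K τ * (u ^ (H - 3/2) * Real.exp (-(u * τ ^ 2))) := by
        refine setIntegral_congr_fun measurableSet_Ioi fun u (hu : 0 < u) => ?_
        have h1 : ∫ τ, K τ * (u ^ (H - 3/2) * Real.exp (-(u * τ ^ 2))) =
            u ^ (H - 3/2) * ∫ τ, ∫ p,
              w p * (Real.exp (-(u * τ ^ 2)) * Real.cos (x p * (τ + b))) ∂P := by
          rw [← integral_const_mul]
          refine integral_congr_ae (ae_of_all _ fun τ => ?_)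
          simp only [hKdef]
          rw [mul_left_comm, ← integral_mul_const]
          congr 2
          ext p
          ring
        rw [h1, ← integral_integral_swap (hint2 u hu), ← integral_const_mul, ← integral_const_mul]
        refine integral_congr_ae (ae_of_all _ fun p => ?_)
        simp only
        rw [integral_const_mul, integral_exp_neg_mul_sq_mul_cos hu, Real.sqrt_div Real.pi_pos.le]
        have e : u ^ (H - 3/2) = u ^ (H - 2) * √u := by
          rw [Real.sqrt_eq_rpow, ← Real.rpow_add hu]
          ring_nf
        rw [e]
        have : 0 < √u := Real.sqrt_pos.2 hu
        have : 0 < √π := Real.sqrt_pos.2 Real.pi_pos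
        field_simp
    _ = (√π)⁻¹ * ∫ τ, ∫ u in Set.Ioi (0:ℝ),
          K τ * (u ^ (H - 3/2) * Real.exp (-(u * τ ^ 2))) := by
        rw [integral_const_mul]
        congr 1
        have e : ∀ τ, ∫ u in Set.Ioi (0:ℝ), K τ * (u ^ (H - 3/2) * Real.exp (-(u * τ ^ 2))) =
            ∫ u in Set.Ioi (0:ℝ), K τ * (|u| ^ (H - 3/2) * Real.exp (-(u * τ ^ 2))) := fun τ =>
          setIntegral_congr_fun measurableSet_Ioi fun u (hu : 0 < u) => by
            simp only [abs_of_pos hu]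
        have e' : ∫ u in Set.Ioi (0:ℝ), ∫ τ, K τ * (u ^ (H - 3/2) * Real.exp (-(u * τ ^ 2))) =
            ∫ u in Set.Ioi (0:ℝ), ∫ τ, K τ * (|u| ^ (H - 3/2) * Real.exp (-(u * τ ^ 2))) :=
          setIntegral_congr_fun measurableSet_Ioi fun u (hu : 0 < u) => by
            simp only [abs_of_pos hu]
        rw [e']
        simp only [e]
        refine integral_integral_swap_of_nonneg ?_ ?_ ?_ ?_
        · have h2 : Measurable (fun z : ℝ × ℝ =>
            |z.1| ^ (H - 3/2) * Real.exp (-(z.1 * z.2 ^ 2))) := by fun_prop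
          exact hKm.comp_snd.mul h2.aestronglyMeasurable
        · intro u τ
          have := hK τ
          positivity
        · filter_upwards [ae_restrict_mem measurableSet_Ioi] with u hu
          refine ((hint2 u hu).integral_prod_right.const_mul (|u| ^ (H - 3/2))).congr
            (ae_of_all _ fun τ => ?_)
          simp only [hKdef, Function.uncurry_apply_pair]
          rw [← integral_const_mul, ← integral_mul_const]
          congr 1
          ext p
          ring
        · have h0 : ∀ᵐ τ : ℝ, τ ≠ 0 := by simp [ae_iff]
          filter_upwards [h0] with τ hτ
          refine Integrable.const_mul ?_ _
          refine Integrable.of_integral_ne_zero ?_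
          have e2 := integral_rpow_mul_exp_neg_mul_sq_Ioi hH τ
          have := Real.rpow_pos_of_pos (abs_pos.2 hτ) (-(2 * H - 1))
          rw [show (∫ u in Set.Ioi (0:ℝ), |u| ^ (H - 3/2) * Real.exp (-(u * τ ^ 2))) = _ from
            setIntegral_congr_fun measurableSet_Ioi fun u (hu : 0 < u) => by
              simp only [abs_of_pos hu]; rfl, e2]
          positivity
    _ = _ := by
        rw [div_eq_inv_mul (Real.Gamma _), mul_assoc]
        congr 1
        rw [← integral_const_mul]
        refine integral_congr_ae (ae_of_all _ fun τ => ?_)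
        simp only
        rw [integral_const_mul, integral_rpow_mul_exp_neg_mul_sq_Ioi hH]
        ring

theorem integrable_abs_sub_rpow {β : ℝ} (hβ : -1 < β) (T : ℝ) :
    Integrable (fun p : ℝ × ℝ => |p.1 - p.2| ^ β)
      ((volume.restrict (Set.Ioc 0 T)).prod (volume.restrict (Set.Ioc 0 T))) := by
  have hI : IntervalIntegrable (fun x : ℝ => |x| ^ β) volume (-T) T := by
    have h0 : ∀ S : ℝ, 0 ≤ S → IntervalIntegrable (fun x : ℝ => |x| ^ β) volume 0 S := by
      intro S hS
      refine (intervalIntegral.intervalIntegrable_rpow' hβ).congr fun x hx => ?_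
      rw [Set.uIoc_of_le hS] at hx
      simp only [abs_of_pos hx.1]
    rcases le_total 0 T with hT | hT
    · refine IntervalIntegrable.trans (b := 0) ?_ (h0 T hT)
      simpa using ((h0 T hT).comp_sub_left 0).symm
    · refine IntervalIntegrable.trans (b := 0) (h0 _ (by linarith)).symm ?_
      simpa using (h0 (-T) (by linarith)).comp_sub_left 0
  rcases le_total T 0 with hT | hT
  · simp [Set.Ioc_eq_empty_of_le hT]
  have hg : Integrable ((Set.Ioc (-T) T).indicator fun x : ℝ => |x| ^ β) := by
    rw [integrable_indicator_iff measurableSet_Ioc]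
    exact (intervalIntegrable_iff_integrableOn_Ioc_of_le (by linarith)).1 hI
  have hf : Integrable ((Set.Ioc 0 T).indicator fun _ : ℝ => (1 : ℝ)) := by
    rw [integrable_indicator_iff measurableSet_Ioc]
    simp
  have h := (hf.convolution_integrand (ContinuousLinearMap.mul ℝ ℝ) hg).restrict
    (s := Set.Ioc 0 T ×ˢ Set.Ioc 0 T)
  rw [Measure.prod_restrict]
  refine h.congr ?_
  filter_upwards [ae_restrict_mem (measurableSet_Ioc.prod measurableSet_Ioc)] with p hp
  obtain ⟨h1, h2⟩ := hp
  have h3 : p.1 - p.2 ∈ Set.Ioc (-T) T := ⟨by linarith [h1.1, h2.2], by linarith [h1.2, h2.1]⟩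
  simp [Set.indicator_of_mem h2, Set.indicator_of_mem h3]

theorem sq_integral_exp_mul_cos_add_sq_integral_exp_mul_sin {T : ℝ} (hT : 0 ≤ T) (a c : ℝ)
    (h : a ≠ 0 ∨ c ≠ 0) :
    (∫ r in Set.Ioc 0 T, Real.exp (-(r * a)) * Real.cos (r * c)) ^ 2 +
      (∫ r in Set.Ioc 0 T, Real.exp (-(r * a)) * Real.sin (r * c)) ^ 2 =
    (Real.sin (c * T) ^ 2 + (Real.exp (-(a * T)) - Real.cos (c * T)) ^ 2) / (a ^ 2 + c ^ 2) := by
  set z : ℂ := ⟨-a, c⟩ with hz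
  have hz0 : z ≠ 0 := by
    intro h0
    have h1 := congrArg Complex.re h0
    have h2 := congrArg Complex.im h0
    simp [hz] at h1 h2
    tauto
  have hi := integral_exp_mul_complex (a := 0) (b := T) hz0
  rw [intervalIntegral.integral_of_le hT] at hi
  have hint : Integrable (fun r : ℝ => Complex.exp (z * r)) (volume.restrict (Set.Ioc 0 T)) :=
    (Continuous.integrableOn_Icc (by fun_prop)).mono_set Set.Ioc_subset_Icc_self
  have hre := integral_re hint
  have him := integral_im hint
  simp only [RCLike.re_eq_complex_re, RCLike.im_eq_complex_im] at hre him
  have e1 : ∀ r : ℝ, (Complex.exp (z * r)).re = Real.exp (-(r * a)) * Real.cos (r * c) := by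
    intro r
    rw [Complex.exp_re]
    simp [hz, mul_comm]
  have e2 : ∀ r : ℝ, (Complex.exp (z * r)).im = Real.exp (-(r * a)) * Real.sin (r * c) := by
    intro r
    rw [Complex.exp_im]
    simp [hz, mul_comm]
  simp only [e1, e2] at hre him
  rw [hre, him, hi, sq, sq, ← Complex.normSq_apply, Complex.normSq_div]
  congr 1
  · have hE := Real.exp_pos (-(T * a))
    rw [Complex.normSq_apply]
    simp only [Complex.sub_re, Complex.sub_im, e1, e2]
    simp only [zero_mul, neg_zero, Real.exp_zero, Real.cos_zero, Real.sin_zero, mul_one, mul_zero,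
      sub_zero, mul_comm c T, mul_comm a T]
    linear_combination (Real.exp (-(T * a)) ^ 2 - 1) * Real.sin_sq_add_cos_sq (T * c)
  · rw [Complex.normSq_apply]
    simp [hz]
    ring

theorem integral_prod_exp_mul_cos_sub (T a c : ℝ) :
    ∫ p : ℝ × ℝ, Real.exp (-((p.1 + p.2) * a)) * Real.cos ((p.1 - p.2) * c)
        ∂((volume.restrict (Set.Ioc 0 T)).prod (volume.restrict (Set.Ioc 0 T))) =
      (∫ r in Set.Ioc 0 T, Real.exp (-(r * a)) * Real.cos (r * c)) ^ 2 +
        (∫ r in Set.Ioc 0 T, Real.exp (-(r * a)) * Real.sin (r * c)) ^ 2 := by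
  have hc : Integrable (fun r => Real.exp (-(r * a)) * Real.cos (r * c))
      (volume.restrict (Set.Ioc 0 T)) :=
    (Continuous.integrableOn_Icc (by fun_prop)).mono_set Set.Ioc_subset_Icc_self
  have hs : Integrable (fun r => Real.exp (-(r * a)) * Real.sin (r * c))
      (volume.restrict (Set.Ioc 0 T)) :=
    (Continuous.integrableOn_Icc (by fun_prop)).mono_set Set.Ioc_subset_Icc_self
  rw [sq, sq, ← integral_prod_mul, ← integral_prod_mul,
    ← integral_add (hc.mul_prod hc) (hs.mul_prod hs)]
  congr 1
  ext p
  rw [sub_mul, Real.cos_sub, add_mul, neg_add, Real.exp_add]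
  ring

/-- Lemma B.1: the `H(0,T)`-norm of the complex exponential `φ(x) = e^{-x(a+ib)}` in the
spectral domain.  There is a constant `c_H > 0`, depending only on `H`, such that for all
`T > 0` and all `a, b ∈ ℝ`,
`α_H ∫₀ᵀ∫₀ᵀ e^{-(r+s)a} cos((r-s)b) |r-s|^{2H-2} dr ds
  = c_H ∫_ℝ (sin²((τ+b)T) + (e^{-aT} - cos((τ+b)T))²)/(a² + (τ+b)²) · |τ|^{-(2H-1)} dτ`. -/
theorem H_norm_of_exponential_spectral (H : ℝ) (hH : 1/2 < H) (hH1 : H < 1) :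
    ∃ c : ℝ, 0 < c ∧
      ∀ T : ℝ, 0 < T → ∀ a b : ℝ,
        (H * (2*H - 1)) *
          ∫ r in (0:ℝ)..T, ∫ s in (0:ℝ)..T,
            Real.exp (-((r + s) * a)) * Real.cos ((r - s) * b) * |r - s| ^ (2*H - 2)
        = c * ∫ τ : ℝ,
            (Real.sin ((τ + b) * T) ^ 2 +
              (Real.exp (-(a * T)) - Real.cos ((τ + b) * T)) ^ 2) /
              (a^2 + (τ + b)^2) * |τ| ^ (-(2*H - 1)) := by
  have hG : 0 < Real.Gamma (1 - H) := Real.Gamma_pos_of_pos (by linarith)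
  have hG2 : 0 < Real.Gamma (H - 1/2) := Real.Gamma_pos_of_pos (by linarith)
  have hπ : 0 < √π := Real.sqrt_pos.2 Real.pi_pos
  have hα : 0 < H * (2 * H - 1) := mul_pos (by linarith) (by linarith)
  refine ⟨H * (2 * H - 1) *
    (Real.Gamma (H - 1/2) / √π / (4 ^ (1 - H) * Real.Gamma (1 - H))), by positivity, ?_⟩
  intro T hT a b
  set μ : Measure ℝ := volume.restrict (Set.Ioc 0 T) with hμ
  have hw : Integrable (fun p : ℝ × ℝ => Real.exp (-((p.1 + p.2) * a))) (μ.prod μ) := by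
    rw [hμ, Measure.prod_restrict]
    refine IntegrableOn.mono_set (t := Set.Icc 0 T ×ˢ Set.Icc 0 T) ?_
      (Set.prod_mono Set.Ioc_subset_Icc_self Set.Ioc_subset_Icc_self)
    exact ContinuousOn.integrableOn_compact (isCompact_Icc.prod isCompact_Icc) (by fun_prop)
  have hI := integrable_abs_sub_rpow (β := 2 * H - 2) (by linarith) T
  have hwx : Integrable (fun p : ℝ × ℝ =>
      Real.exp (-((p.1 + p.2) * a)) * |p.1 - p.2| ^ (2 * H - 2)) (μ.prod μ) := by
    refine hI.bdd_mul (c := Real.exp (2 * T * |a|)) (by fun_prop) ?_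
    rw [Measure.prod_restrict]
    filter_upwards [ae_restrict_mem (measurableSet_Ioc.prod measurableSet_Ioc)] with p hp
    obtain ⟨h1, h2⟩ := hp
    rw [Real.norm_of_nonneg (Real.exp_pos _).le, Real.exp_le_exp]
    have h3 : 0 ≤ p.1 + p.2 := by linarith [h1.1, h2.1]
    calc -((p.1 + p.2) * a) ≤ (p.1 + p.2) * |a| := by nlinarith [neg_abs_le a]
      _ ≤ 2 * T * |a| := by
        gcongr
        linarith [h1.2, h2.2]
  have hx0 : ∀ᵐ p ∂(μ.prod μ), p.1 - p.2 ≠ 0 := by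
    rw [Measure.ae_prod_iff_ae_ae]
    · refine ae_of_all _ fun r => ?_
      have : ∀ᵐ s : ℝ, s ≠ r := by simp [ae_iff]
      filter_upwards [ae_restrict_of_ae this] with s hs
      exact sub_ne_zero.2 hs.symm
    · exact (measurableSet_eq_fun (by fun_prop) measurable_const).compl
  have key := integral_mul_cos_mul_abs_rpow_eq_spectral hH hH1 (P := μ.prod μ)
    (x := fun p => p.1 - p.2) (by fun_prop) hx0 hw hwx b (fun τ => by
      rw [integral_prod_exp_mul_cos_sub]; positivity)
  have hL : ∫ r in (0:ℝ)..T, ∫ s in (0:ℝ)..T,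
        Real.exp (-((r + s) * a)) * Real.cos ((r - s) * b) * |r - s| ^ (2*H - 2) =
      ∫ p : ℝ × ℝ, Real.exp (-((p.1 + p.2) * a)) * Real.cos ((p.1 - p.2) * b) *
        |p.1 - p.2| ^ (2 * H - 2) ∂(μ.prod μ) := by
    simp only [intervalIntegral.integral_of_le hT.le]
    refine integral_integral (f := fun r s =>
      Real.exp (-((r + s) * a)) * Real.cos ((r - s) * b) * |r - s| ^ (2*H - 2)) ?_
    refine (hwx.bdd_mul (c := 1) (f := fun p => Real.cos ((p.1 - p.2) * b)) (by fun_prop)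
      (ae_of_all _ fun p => by simpa using Real.abs_cos_le_one _)).congr (ae_of_all _ fun p => ?_)
    simp only [Function.uncurry]
    ring
  have hR : ∫ τ : ℝ, (∫ p : ℝ × ℝ, Real.exp (-((p.1 + p.2) * a)) *
        Real.cos ((p.1 - p.2) * (τ + b)) ∂(μ.prod μ)) * |τ| ^ (-(2 * H - 1)) =
      ∫ τ : ℝ, (Real.sin ((τ + b) * T) ^ 2 +
        (Real.exp (-(a * T)) - Real.cos ((τ + b) * T)) ^ 2) /
        (a^2 + (τ + b)^2) * |τ| ^ (-(2*H - 1)) := by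
    have hb : ∀ᵐ τ : ℝ, τ ≠ -b := by simp [ae_iff]
    refine integral_congr_ae ?_
    filter_upwards [hb] with τ hτ
    rw [integral_prod_exp_mul_cos_sub, sq_integral_exp_mul_cos_add_sq_integral_exp_mul_sin hT.le _ _
      (Or.inr fun h => hτ (by linarith))]
  rw [hL, ← hR, mul_assoc (H * (2 * H - 1)), div_mul_eq_mul_div, ← key,
    mul_div_cancel_left₀ _ (by positivity)]
end

section
/- Let H ∈ (1/2, 1) and α_H = H(2H−1). There exists a constant B_H > 0, depending only on H, such that for every measure μ on ℝ^d, every measurable ρ : ℝ^d → [0,∞), and every α > 0, the quantities Υ_H(α) := α_H ∫_{ℝ^d} ∫₀^∞ ∫₀^∞ |r−s|^{2H−2} e^{−(α+ρ(ξ))(r+s)} dr ds μ(dξ) and Υ*_H(α) := ∫_{ℝ^d} (1/(α+ρ(ξ)))^{2H} μ(dξ) (values in [0,∞]) satisfy c_{α,H} · Υ*_H(α) ≤ Υ_H(α) ≤ B_H · Υ*_H(α), where c_{α,H} = 2^{−(2H+2)} · (min(α,1)/(α + 3/2))^{2H}. -/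
open MeasureTheory

theorem lintegral_rpow_mul_exp_neg_mul_Ioi {a b : ℝ} (ha : 0 < a) (hb : 0 < b) :
    ∫⁻ t in Set.Ioi (0:ℝ), ENNReal.ofReal (t ^ (a - 1) * Real.exp (-(b * t))) =
      ENNReal.ofReal ((1 / b) ^ a * Real.Gamma a) := by
  have h := Real.integral_rpow_mul_exp_neg_mul_Ioi ha hb
  have hpos : 0 < (1 / b) ^ a * Real.Gamma a := by
    have := Real.Gamma_pos_of_pos ha
    positivity
  have hint : Integrable (fun t : ℝ => t ^ (a - 1) * Real.exp (-(b * t)))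
      (volume.restrict (Set.Ioi 0)) := by
    by_contra hn
    rw [integral_undef hn] at h
    exact hpos.ne h
  rw [← h, ofReal_integral_eq_lintegral_ofReal hint]
  filter_upwards [ae_restrict_mem measurableSet_Ioi] with t ht
  have : 0 < t := ht
  positivity

theorem lintegral_Ioi_abs_sub_rpow_mul_exp {a b r : ℝ} (ha : 0 < a) (hb : 0 < b) :
    ∫⁻ s in Set.Ioi r, ENNReal.ofReal (|r - s| ^ (a - 1) * Real.exp (-(b * (r + s)))) =
      ENNReal.ofReal ((1 / b) ^ a * Real.Gamma a) *
        ENNReal.ofReal (Real.exp (-(2 * b * r))) := by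
  rw [← lintegral_rpow_mul_exp_neg_mul_Ioi ha hb,
    ← lintegral_mul_const' _ _ ENNReal.ofReal_ne_top,
    ← lintegral_indicator measurableSet_Ioi, ← lintegral_indicator measurableSet_Ioi,
    ← lintegral_add_right_eq_self _ r]
  congr 1 with t
  by_cases ht : 0 < t
  · rw [Set.indicator_of_mem (by simpa using ht), Set.indicator_of_mem (by simpa using ht),
      ← ENNReal.ofReal_mul (by positivity), mul_assoc, ← Real.exp_add]
    rw [show r - (t + r) = -t by ring, abs_neg, abs_of_pos ht]
    ring_nf
  · rw [Set.indicator_of_notMem (by simpa using ht), Set.indicator_of_notMem (by simpa using ht)]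

theorem lintegral_lintegral_eq_two_mul_of_symm {f : ℝ → ℝ → ENNReal}
    (hf : Measurable (Function.uncurry f)) (hsymm : ∀ r s, f r s = f s r)
    (hdiag : ∀ r, f r r = 0) :
    ∫⁻ r in Set.Ioi (0:ℝ), ∫⁻ s in Set.Ioi (0:ℝ), f r s =
      2 * ∫⁻ r in Set.Ioi (0:ℝ), ∫⁻ s in Set.Ioi r, f r s := by
  set K : ℝ → ℝ → ENNReal := fun r s => if r < s then f r s else 0 with hK
  have hKm : Measurable (Function.uncurry K) :=
    Measurable.ite (measurableSet_lt measurable_fst measurable_snd) hf measurable_const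
  have hsplit : ∀ r s, f r s = K r s + K s r := by
    intro r s
    rcases lt_trichotomy r s with h | h | h
    · simp [hK, h, h.not_gt]
    · simp [hK, h, hdiag]
    · simp [hK, h, h.not_gt, hsymm r s]
  have hinner : ∀ r ∈ Set.Ioi (0:ℝ),
      ∫⁻ s in Set.Ioi (0:ℝ), K r s = ∫⁻ s in Set.Ioi r, f r s := by
    intro r hr
    rw [← lintegral_indicator measurableSet_Ioi, ← lintegral_indicator measurableSet_Ioi]
    congr 1 with s
    by_cases h : r < s
    · have : 0 < s := lt_trans hr h
      simp [hK, h, this]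
    · simp [hK, h]
  have hswap : ∫⁻ r in Set.Ioi (0:ℝ), ∫⁻ s in Set.Ioi (0:ℝ), K s r =
      ∫⁻ r in Set.Ioi (0:ℝ), ∫⁻ s in Set.Ioi (0:ℝ), K r s :=
    (lintegral_lintegral_swap hKm.aemeasurable).symm
  rw [← setLIntegral_congr_fun measurableSet_Ioi hinner, two_mul]
  nth_rewrite 2 [← hswap]
  rw [← lintegral_add_left (by exact hKm.lintegral_prod_right')]
  congr 1 with r
  simp_rw [hsplit r]
  exact lintegral_add_left (hKm.comp measurable_prodMk_left) _

theorem lintegral_lintegral_abs_sub_rpow_mul_exp {a b : ℝ} (ha : 0 < a) (ha1 : a ≠ 1)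
    (hb : 0 < b) :
    ∫⁻ r in Set.Ioi (0:ℝ), ∫⁻ s in Set.Ioi (0:ℝ),
        ENNReal.ofReal (|r - s| ^ (a - 1) * Real.exp (-(b * (r + s)))) =
      ENNReal.ofReal (Real.Gamma a * (1 / b) ^ (a + 1)) := by
  have hG := Real.Gamma_pos_of_pos ha
  have hexp : ∫⁻ r in Set.Ioi (0:ℝ), ENNReal.ofReal (Real.exp (-(2 * b * r))) =
      ENNReal.ofReal (1 / (2 * b)) := by
    simpa using lintegral_rpow_mul_exp_neg_mul_Ioi one_pos (mul_pos two_pos hb)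
  rw [lintegral_lintegral_eq_two_mul_of_symm]
  · simp_rw [lintegral_Ioi_abs_sub_rpow_mul_exp ha hb]
    rw [lintegral_const_mul' _ _ ENNReal.ofReal_ne_top, hexp,
      ← ENNReal.ofReal_mul (by positivity), show (2 : ENNReal) = ENNReal.ofReal 2 by simp,
      ← ENNReal.ofReal_mul (by positivity), Real.rpow_add_one (by positivity)]
    congr 1
    field_simp
  · fun_prop
  · intro r s
    rw [abs_sub_comm, add_comm]
  · intro r
    simp [Real.zero_rpow (sub_ne_zero.2 ha1)]

theorem two_rpow_neg_mul_min_div_rpow_le {x α : ℝ} (hx : 0 ≤ x) (hα : 0 < α) :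
    2 ^ (-(x + 2)) * (min α 1 / (α + 3/2)) ^ x ≤ (1 / 2 : ℝ) := by
  have h1 : (2:ℝ) ^ (-(x + 2)) ≤ 2 ^ (-1 : ℝ) :=
    Real.rpow_le_rpow_of_exponent_le one_le_two (by linarith)
  have h0 : 0 ≤ min α 1 / (α + 3/2) := by positivity
  have h2 : (min α 1 / (α + 3/2)) ^ x ≤ 1 := by
    refine Real.rpow_le_one h0 ?_ hx
    rw [div_le_one (by positivity)]
    linarith [min_le_left α 1]
  calc _ ≤ (2:ℝ) ^ (-1 : ℝ) * 1 := by gcongr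
    _ = 1 / 2 := by norm_num [Real.rpow_neg_one]

/-- Lemma 3.10: for `H ∈ (1/2,1)` and `α_H = H(2H-1)` there is a constant `B_H > 0`,
depending only on `H`, such that for every measure `μ` on `ℝ^d`, every measurable
`ρ : ℝ^d → [0,∞)` and every `α > 0`, the quantities
`Υ_H(α) = α_H ∫∫₀^∞∫₀^∞ |r-s|^{2H-2} e^{-(α+ρ(ξ))(r+s)} dr ds μ(dξ)` and
`Υ*_H(α) = ∫ (1/(α+ρ(ξ)))^{2H} μ(dξ)` (values in `[0,∞]`) satisfy
`c_{α,H} Υ*_H(α) ≤ Υ_H(α) ≤ B_H Υ*_H(α)`, with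
`c_{α,H} = 2^{-(2H+2)} (min(α,1)/(α+3/2))^{2H}`. -/
theorem upsilon_comparison (H : ℝ) (hH : 1/2 < H) (hH1 : H < 1) :
    ∃ B : ℝ, 0 < B ∧
      ∀ (d : ℕ) (μ : Measure (EuclideanSpace ℝ (Fin d)))
        (ρ : EuclideanSpace ℝ (Fin d) → ℝ), Measurable ρ → (∀ ξ, 0 ≤ ρ ξ) →
        ∀ α : ℝ, 0 < α →
        ENNReal.ofReal (2 ^ (-(2*H + 2)) * (min α 1 / (α + 3/2)) ^ (2*H)) *
            (∫⁻ ξ, ENNReal.ofReal ((1 / (α + ρ ξ)) ^ (2*H)) ∂μ)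
          ≤ ENNReal.ofReal (H * (2*H - 1)) *
              ∫⁻ ξ, (∫⁻ r in Set.Ioi (0:ℝ), ∫⁻ s in Set.Ioi (0:ℝ),
                ENNReal.ofReal
                  (|r - s| ^ (2*H - 2) * Real.exp (-((α + ρ ξ) * (r + s))))) ∂μ ∧
        ENNReal.ofReal (H * (2*H - 1)) *
            (∫⁻ ξ, (∫⁻ r in Set.Ioi (0:ℝ), ∫⁻ s in Set.Ioi (0:ℝ),
              ENNReal.ofReal
                (|r - s| ^ (2*H - 2) * Real.exp (-((α + ρ ξ) * (r + s))))) ∂μ)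
          ≤ ENNReal.ofReal B * ∫⁻ ξ, ENNReal.ofReal ((1 / (α + ρ ξ)) ^ (2*H)) ∂μ := by
  have hG : 0 < Real.Gamma (2 * H - 1) := Real.Gamma_pos_of_pos (by linarith)
  have hGamma : 1 / 2 ≤ H * (2 * H - 1) * Real.Gamma (2 * H - 1) := by
    have h1 := Real.Gamma_add_one (s := 2 * H - 1) (by linarith)
    have h2 := Real.Gamma_add_one (s := 2 * H) (by linarith)
    rw [sub_add_cancel] at h1
    have h3 : Real.Gamma 2 ≤ Real.Gamma (2 * H + 1) :=
      Real.Gamma_strictMonoOn_Ici.monotoneOn (by simp)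
        (Set.mem_Ici.2 (by linarith)) (by linarith)
    rw [Real.Gamma_two, h2, h1] at h3
    linarith
  refine ⟨H * (2 * H - 1) * Real.Gamma (2 * H - 1), by linarith, ?_⟩
  intro d μ ρ _ hρ α hα
  have hkey : ∀ ξ, (∫⁻ r in Set.Ioi (0:ℝ), ∫⁻ s in Set.Ioi (0:ℝ),
      ENNReal.ofReal (|r - s| ^ (2*H - 2) * Real.exp (-((α + ρ ξ) * (r + s))))) =
      ENNReal.ofReal (Real.Gamma (2 * H - 1)) *
        ENNReal.ofReal ((1 / (α + ρ ξ)) ^ (2*H)) := by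
    intro ξ
    have h := lintegral_lintegral_abs_sub_rpow_mul_exp (a := 2 * H - 1) (b := α + ρ ξ)
      (by linarith) (by linarith) (by linarith [hρ ξ])
    rwa [sub_add_cancel, ENNReal.ofReal_mul hG.le,
      show 2 * H - 1 - 1 = 2 * H - 2 by ring] at h
  simp_rw [hkey]
  rw [lintegral_const_mul' _ _ ENNReal.ofReal_ne_top, ← mul_assoc,
    ← ENNReal.ofReal_mul (mul_nonneg (by linarith) (by linarith) : 0 ≤ H * (2 * H - 1))]
  refine ⟨?_, le_rfl⟩
  exact mul_le_mul' (ENNReal.ofReal_le_ofReal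
    ((two_rpow_neg_mul_min_div_rpow_le (by linarith) hα).trans hGamma)) le_rfl
end

section
/- Let d ≥ 1 be an integer, β > 0, H ∈ (1/2, 1), and H₁, …, H_d ∈ (1/2, 1). Then ∫_{ℝ^d} (1/(1 + |ξ|^β))^{2H} · ∏_{i=1}^d |ξ_i|^{−(2H_i−1)} dξ < ∞ if and only if 2Hβ > d − ∑_{i=1}^d (2H_i − 1). -/
open MeasureTheory

section CoordWeight

open Set

variable {ι : Type*} [Fintype ι]

/-- The homogeneous weight `∏ i, |ξ i| ^ (-a i)` on Euclidean space. -/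
noncomputable def coordWeight (a : ι → ℝ) (ξ : EuclideanSpace ℝ ι) : ℝ :=
  ∏ i, |ξ i| ^ (-a i)

lemma coordWeight_nonneg (a : ι → ℝ) (ξ : EuclideanSpace ℝ ι) : 0 ≤ coordWeight a ξ :=
  Finset.prod_nonneg fun _ _ => by positivity

lemma measurable_coordWeight (a : ι → ℝ) : Measurable (coordWeight a) := by
  unfold coordWeight
  fun_prop

lemma coordWeight_smul (a : ι → ℝ) {c : ℝ} (hc : 0 < c) (ξ : EuclideanSpace ℝ ι) :
    coordWeight a (c • ξ) = c ^ (-∑ i, a i) * coordWeight a ξ := by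
  simp only [coordWeight, PiLp.smul_apply, smul_eq_mul, abs_mul, abs_of_pos hc]
  rw [← Finset.sum_neg_distrib, Real.rpow_sum_of_pos hc, ← Finset.prod_mul_distrib]
  exact Finset.prod_congr rfl fun i _ => Real.mul_rpow hc.le (abs_nonneg _)

lemma integrableOn_abs_rpow {s : ℝ} (hs : -1 < s) (r : ℝ) :
    IntegrableOn (fun x : ℝ => |x| ^ s) (Icc (-r) r) := by
  rcases le_or_gt 0 r with hr | hr
  · have h : IntervalIntegrable (fun x : ℝ => |x| ^ s) volume (-r) r := by
      refine intervalIntegrable_of_even (fun x => by simp) (fun x hx => ?_)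
        enorm_ne_top enorm_ne_top
      refine (intervalIntegral.intervalIntegrable_rpow' (a := 0) (b := x) hs).congr ?_
      intro y hy
      rw [uIoc_of_le hx.le] at hy
      simp [abs_of_pos hy.1]
    rw [intervalIntegrable_iff_integrableOn_Ioc_of_le (by linarith)] at h
    rwa [integrableOn_Icc_iff_integrableOn_Ioc]
  · simp [Icc_eq_empty (show ¬ -r ≤ r by linarith)]

/-- The weight is integrable on bounded sets. -/
lemma setLIntegral_coordWeight_lt_top {a : ι → ℝ} (ha : ∀ i, a i < 1) (r : ℝ) :
    ∫⁻ ξ in norm ⁻¹' Iio r, ENNReal.ofReal (coordWeight a ξ) < ⊤ := by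
  have hint : IntegrableOn (fun x : ι → ℝ => ∏ i, |x i| ^ (-a i))
      (univ.pi fun _ => Icc (-r) r) := by
    rw [IntegrableOn, volume_pi, Measure.restrict_pi_pi]
    exact Integrable.fintype_prod (f := fun i (x : ℝ) => |x| ^ (-a i))
      fun i => integrableOn_abs_rpow (by linarith [ha i]) r
  have hbox : (norm ⁻¹' Iio r : Set (EuclideanSpace ℝ ι)) ⊆
      WithLp.ofLp ⁻¹' (univ.pi fun _ => Icc (-r) r) := fun ξ hξ i _ => by
    have := (PiLp.norm_apply_le ξ i).trans (le_of_lt hξ)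
    exact abs_le.1 this
  calc ∫⁻ ξ in norm ⁻¹' Iio r, ENNReal.ofReal (coordWeight a ξ)
      ≤ ∫⁻ ξ in WithLp.ofLp ⁻¹' (univ.pi fun _ => Icc (-r) r),
          ENNReal.ofReal (coordWeight a ξ) := lintegral_mono_set hbox
    _ = ∫⁻ x in univ.pi fun _ => Icc (-r) r, ENNReal.ofReal (∏ i, |x i| ^ (-a i)) :=
        (PiLp.volume_preserving_ofLp ι).setLIntegral_comp_preimage
          (MeasurableSet.univ_pi fun _ => measurableSet_Icc)
          (f := fun x : ι → ℝ => ENNReal.ofReal (∏ i, |x i| ^ (-a i))) (by fun_prop)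
    _ < ⊤ := hint.lintegral_lt_top

lemma setLIntegral_coordWeight_annulus_pos [Nonempty ι] (a : ι → ℝ) {r R : ℝ} (hr : 0 ≤ r)
    (hrR : r < R) :
    0 < ∫⁻ ξ in norm ⁻¹' Ico r R, ENNReal.ofReal (coordWeight a ξ) := by
  rw [setLIntegral_pos_iff (measurable_coordWeight a).ennreal_ofReal]
  let U : Set (EuclideanSpace ℝ ι) := norm ⁻¹' Ioo r R ∩ ⋂ i, {ξ | 0 < ξ i}
  have hU : IsOpen U := by
    refine (isOpen_Ioo.preimage continuous_norm).inter (isOpen_iInter_of_finite fun i => ?_)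
    exact isOpen_lt continuous_const (by fun_prop)
  have hne : U.Nonempty := by
    let e : EuclideanSpace ℝ ι := WithLp.toLp 2 fun _ => 1
    have he : 0 < ‖e‖ := norm_pos_iff.2 fun h => by
      obtain ⟨i⟩ := ‹Nonempty ι›
      simpa [e] using congrArg (fun v : EuclideanSpace ℝ ι => v i) h
    have hm : 0 < (r + R) / 2 := by linarith
    refine ⟨((r + R) / 2 / ‖e‖) • e, ?_, mem_iInter.2 fun i => ?_⟩
    · rw [mem_preimage, norm_smul, Real.norm_of_nonneg (by positivity), div_mul_cancel₀ _ he.ne']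
      constructor <;> linarith
    · simp only [mem_ofPred_eq, PiLp.smul_apply, e, smul_eq_mul, mul_one]
      positivity
  refine (hU.measure_pos volume hne).trans_le (measure_mono fun ξ hξ => ⟨?_, ?_⟩)
  · have hpos : 0 < coordWeight a ξ := Finset.prod_pos fun i _ =>
      Real.rpow_pos_of_pos (abs_pos.2 (mem_iInter.1 hξ.2 i).ne') _
    simpa using hpos
  · exact Ioo_subset_Ico_self hξ.1

lemma setLIntegral_coordWeight_annulus_mul (a : ι → ℝ) {c : ℝ} (hc : 0 < c) (r R : ℝ) :
    ∫⁻ ξ in norm ⁻¹' Ico (c * r) (c * R), ENNReal.ofReal (coordWeight a ξ) =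
      ENNReal.ofReal (c ^ ((Fintype.card ι : ℝ) - ∑ i, a i)) *
        ∫⁻ ξ in norm ⁻¹' Ico r R, ENNReal.ofReal (coordWeight a ξ) := by
  have hmeas := (measurable_coordWeight a).ennreal_ofReal
  have h := setLIntegral_map (μ := (volume : Measure (EuclideanSpace ℝ ι)))
    (s := norm ⁻¹' Ico (c * r) (c * R)) (measurable_norm measurableSet_Ico) hmeas
    (measurable_const_smul c)
  have hpre : (fun ξ : EuclideanSpace ℝ ι => c • ξ) ⁻¹' (norm ⁻¹' Ico (c * r) (c * R)) =
      norm ⁻¹' Ico r R := by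
    ext ξ
    simp [norm_smul, abs_of_pos hc, hc]
  rw [Measure.map_addHaar_smul _ hc.ne', setLIntegral_smul_measure, hpre,
    finrank_euclideanSpace, smul_eq_mul, abs_of_pos (by positivity)] at h
  simp only [coordWeight_smul a hc,
    ENNReal.ofReal_mul (Real.rpow_nonneg hc.le (-∑ i, a i))] at h
  rw [lintegral_const_mul _ hmeas] at h
  rw [sub_eq_add_neg, Real.rpow_add hc, ENNReal.ofReal_mul (by positivity), mul_assoc, ← h,
    ← mul_assoc, ← ENNReal.ofReal_mul (by positivity), Real.rpow_natCast,
    mul_inv_cancel₀ (by positivity), ENNReal.ofReal_one, one_mul]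

lemma setLIntegral_coordWeight_dyadic (a : ι → ℝ) (k : ℕ) :
    ∫⁻ ξ in norm ⁻¹' Ico (2 ^ k) (2 ^ (k + 1)), ENNReal.ofReal (coordWeight a ξ) =
      ENNReal.ofReal (2 ^ ((Fintype.card ι : ℝ) - ∑ i, a i)) ^ k *
        ∫⁻ ξ in norm ⁻¹' Ico 1 2, ENNReal.ofReal (coordWeight a ξ) := by
  have h := setLIntegral_coordWeight_annulus_mul a (show (0 : ℝ) < 2 ^ k by positivity) 1 2
  rwa [mul_one, ← pow_succ, ← Real.rpow_pow_comm zero_le_two,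
    ENNReal.ofReal_pow (by positivity)] at h

end CoordWeight

section Radial

open Set

lemma one_div_one_add_rpow_le {β γ r t : ℝ} (hβ : 0 < β) (hγ : 0 < γ) (ht : 0 < t)
    (htr : t ≤ r) : (1 / (1 + r ^ β)) ^ γ ≤ t ^ (-(γ * β)) := by
  have hr : 0 < r := ht.trans_le htr
  calc (1 / (1 + r ^ β)) ^ γ ≤ (1 / t ^ β) ^ γ := by
        gcongr
        linarith [Real.rpow_le_rpow ht.le htr hβ.le]
    _ = t ^ (-(γ * β)) := by
        rw [one_div, ← Real.rpow_neg ht.le, ← Real.rpow_mul ht.le]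
        ring_nf

lemma le_one_div_one_add_rpow {β γ r t : ℝ} (hβ : 0 < β) (hγ : 0 < γ) (hr : 0 ≤ r)
    (ht : 1 ≤ t) (hrt : r ≤ 2 * t) :
    (1 + 2 ^ β) ^ (-γ) * t ^ (-(γ * β)) ≤ (1 / (1 + r ^ β)) ^ γ := by
  have ht0 : 0 < t := by linarith
  have h1 : 1 ≤ t ^ β := Real.one_le_rpow ht hβ.le
  have h2 : r ^ β ≤ 2 ^ β * t ^ β := by
    rw [← Real.mul_rpow zero_le_two ht0.le]
    exact Real.rpow_le_rpow hr hrt hβ.le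
  calc (1 + 2 ^ β) ^ (-γ) * t ^ (-(γ * β)) = (1 / ((1 + 2 ^ β) * t ^ β)) ^ γ := by
        rw [one_div, Real.inv_rpow (by positivity), ← Real.rpow_neg (by positivity),
          Real.mul_rpow (by positivity) (by positivity), ← Real.rpow_mul ht0.le]
        ring_nf
    _ ≤ (1 / (1 + r ^ β)) ^ γ := by
        gcongr
        nlinarith

/-- A radial function decaying like `‖ξ‖ ^ (-(γ * β))` is integrable against a homogeneous
weight exactly when the decay beats the homogeneity degree of the weighted measure. -/
theorem lintegral_mul_coordWeight_lt_top_iff {ι : Type*} [Fintype ι] [Nonempty ι] {a : ι → ℝ}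
    (ha : ∀ i, a i < 1) {β γ : ℝ} (hβ : 0 < β) (hγ : 0 < γ) :
    ∫⁻ ξ : EuclideanSpace ℝ ι,
        ENNReal.ofReal ((1 / (1 + ‖ξ‖ ^ β)) ^ γ * coordWeight a ξ) < ⊤ ↔
      (Fintype.card ι : ℝ) - ∑ i, a i < γ * β := by
  set s : ℝ := (Fintype.card ι : ℝ) - ∑ i, a i
  set A : ℕ → Set (EuclideanSpace ℝ ι) := fun k => norm ⁻¹' Ico (2 ^ k) (2 ^ (k + 1)) with hA
  set M := ∫⁻ ξ : EuclideanSpace ℝ ι in norm ⁻¹' Ico 1 2, ENNReal.ofReal (coordWeight a ξ)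
  set q := ENNReal.ofReal (2 ^ (s - γ * β)) with hq
  have hAm : ∀ k, MeasurableSet (A k) := fun k => measurable_norm measurableSet_Ico
  have hAd : Pairwise (Function.onFun Disjoint A) := fun i j hij =>
    Disjoint.preimage _ ((pow_right_mono₀ (one_le_two (α := ℝ))).pairwise_disjoint_on_Ico_succ hij)
  have hmeas := (measurable_coordWeight a).ennreal_ofReal
  have hpos : 0 < M := setLIntegral_coordWeight_annulus_pos a zero_le_one one_lt_two
  have hfin : M < ⊤ := (lintegral_mono_set (preimage_mono fun _ h => h.2)).trans_lt
    (setLIntegral_coordWeight_lt_top ha 2)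
  have hqk : ∀ k : ℕ, ENNReal.ofReal (((2 : ℝ) ^ k) ^ (-(γ * β))) *
      ∫⁻ ξ in A k, ENNReal.ofReal (coordWeight a ξ) = q ^ k * M := fun k => by
    rw [hA, setLIntegral_coordWeight_dyadic, ← Real.rpow_pow_comm zero_le_two,
      ENNReal.ofReal_pow (by positivity), ← mul_assoc, ← mul_pow,
      ← ENNReal.ofReal_mul (by positivity), ← Real.rpow_add two_pos, neg_add_eq_sub]
  have hq1 : q < 1 ↔ s < γ * β := by
    rw [hq, ENNReal.ofReal_lt_one, Real.rpow_lt_one_iff_of_pos two_pos]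
    norm_num
  rw [← hq1]
  constructor
  · intro h
    by_contra! hle
    refine h.ne (top_le_iff.1 ?_)
    have hC : (0 : ℝ) < (1 + 2 ^ β) ^ (-γ) := by positivity
    calc ⊤ = ENNReal.ofReal ((1 + 2 ^ β) ^ (-γ)) * ∑' k : ℕ, q ^ k * M := by
          rw [ENNReal.tsum_mul_right, ENNReal.tsum_geometric, tsub_eq_zero_of_le hle,
            ENNReal.inv_zero, ENNReal.top_mul hpos.ne',
            ENNReal.mul_top (ENNReal.ofReal_pos.2 hC).ne']
      _ = ∑' k : ℕ, ∫⁻ ξ in A k, ENNReal.ofReal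
            ((1 + 2 ^ β) ^ (-γ) * ((2 : ℝ) ^ k) ^ (-(γ * β))) *
              ENNReal.ofReal (coordWeight a ξ) := by
          rw [← ENNReal.tsum_mul_left]
          refine tsum_congr fun k => ?_
          rw [lintegral_const_mul _ hmeas, ENNReal.ofReal_mul hC.le, mul_assoc, hqk]
      _ ≤ ∑' k : ℕ, ∫⁻ ξ in A k,
            ENNReal.ofReal ((1 / (1 + ‖ξ‖ ^ β)) ^ γ * coordWeight a ξ) := by
          refine ENNReal.tsum_le_tsum fun k => setLIntegral_mono' (hAm k) fun ξ hξ => ?_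
          rw [ENNReal.ofReal_mul (q := coordWeight a ξ) (by positivity)]
          gcongr
          refine le_one_div_one_add_rpow hβ hγ (norm_nonneg _) (one_le_pow₀ one_le_two) ?_
          rw [← pow_succ']
          exact hξ.2.le
      _ = ∫⁻ ξ in ⋃ k, A k, ENNReal.ofReal ((1 / (1 + ‖ξ‖ ^ β)) ^ γ * coordWeight a ξ) :=
          (lintegral_iUnion hAm hAd _).symm
      _ ≤ _ := setLIntegral_le_lintegral _ _
  · intro h
    have hcover : (univ : Set (EuclideanSpace ℝ ι)) ⊆ norm ⁻¹' Iio 1 ∪ ⋃ k, A k := by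
      intro ξ _
      rcases lt_or_ge ‖ξ‖ 1 with h1 | h1
      · exact Or.inl h1
      · exact Or.inr (mem_iUnion.2 (exists_nat_pow_near h1 one_lt_two))
    rw [← setLIntegral_univ]
    refine (lintegral_mono_set hcover).trans_lt ((lintegral_union_le _ _ _).trans_lt
      (ENNReal.add_lt_top.2 ⟨?_, ?_⟩))
    · refine (lintegral_mono fun ξ => ENNReal.ofReal_le_ofReal ?_).trans_lt
        (setLIntegral_coordWeight_lt_top ha 1)
      refine mul_le_of_le_one_left (coordWeight_nonneg a ξ) (Real.rpow_le_one (by positivity) ?_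
        hγ.le)
      rw [div_le_one (by positivity)]
      linarith [Real.rpow_nonneg (norm_nonneg ξ) β]
    · calc ∫⁻ ξ in ⋃ k, A k, ENNReal.ofReal ((1 / (1 + ‖ξ‖ ^ β)) ^ γ * coordWeight a ξ)
          = ∑' k : ℕ, ∫⁻ ξ in A k,
            ENNReal.ofReal ((1 / (1 + ‖ξ‖ ^ β)) ^ γ * coordWeight a ξ) :=
            lintegral_iUnion hAm hAd _
        _ ≤ ∑' k : ℕ, ∫⁻ ξ in A k, ENNReal.ofReal (((2 : ℝ) ^ k) ^ (-(γ * β))) *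
              ENNReal.ofReal (coordWeight a ξ) := by
            refine ENNReal.tsum_le_tsum fun k => setLIntegral_mono' (hAm k) fun ξ hξ => ?_
            rw [ENNReal.ofReal_mul (by positivity)]
            gcongr
            exact one_div_one_add_rpow_le hβ hγ (by positivity) hξ.1
        _ = (1 - q)⁻¹ * M := by
            simp_rw [lintegral_const_mul _ hmeas, hqk]
            rw [ENNReal.tsum_mul_right, ENNReal.tsum_geometric]
        _ < ⊤ := ENNReal.mul_lt_top (ENNReal.inv_lt_top.2 (tsub_pos_of_lt h)) hfin

end Radial

/-- Example 3.1(ii): for `β > 0`, `H ∈ (1/2,1)` and `H₁, …, H_d ∈ (1/2,1)`,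
`∫_{ℝ^d} (1/(1+|ξ|^β))^{2H} ∏_i |ξ_i|^{-(2H_i-1)} dξ < ∞` if and only if
`2Hβ > d − ∑_i (2H_i − 1)`. -/
theorem parabolic_stable_fractional_condition (d : ℕ) (hd : 1 ≤ d)
    (β H : ℝ) (hβ : 0 < β) (hH : 1/2 < H) (hH1 : H < 1)
    (Hs : Fin d → ℝ) (hHs : ∀ i, 1/2 < Hs i ∧ Hs i < 1) :
    (∫⁻ ξ : EuclideanSpace ℝ (Fin d),
        ENNReal.ofReal ((1 / (1 + ‖ξ‖ ^ β)) ^ (2*H) *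
          ∏ i, |ξ i| ^ (-(2 * Hs i - 1))) < ⊤) ↔
      (d : ℝ) - ∑ i, (2 * Hs i - 1) < 2 * H * β := by
  have : Nonempty (Fin d) := ⟨⟨0, hd⟩⟩
  simpa [coordWeight] using lintegral_mul_coordWeight_lt_top_iff
    (a := fun i => 2 * Hs i - 1) (fun i => by linarith [(hHs i).2]) hβ (γ := 2 * H) (by linarith)
end
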